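/- arXiv:math/9204241 — 2 statements merged into one kernel-verified Lean document; each statement's English description precedes it below -/
import Mathlib

section
/- (Corollary: rigidity of C^1 conjugacies.) Let k ≥ 1, d ≥ 2 be integers with k < 2d and ε ∈ (0,1]. Let g_1,…,g_d and g'_1,…,g'_d be two C^{k+ε} Cantor systems on [0,1], with Cantor sets C and C'. Suppose Φ : ℝ → ℝ is an increasing C^1 diffeomorphism such that Φ(C) = C' and Φ(g_i(x)) = g'_i(Φ(x)) for every i ∈ {1,…,d} and every x ∈ C. Then there exists an increasing C^k diffeomorphism Ψ : ℝ → ℝ whose k-th derivative is ε-Hölder continuous such that Ψ(x) = Φ(x) for all x ∈ C; i.e. the conjugacy between the two Cantor sets extends to a C^{k+ε} diffeomorphism. -/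
open Set Filter

noncomputable section

/-- The unit interval `[0,1] ⊆ ℝ`. -/
abbrev I01 : Set ℝ := Set.Icc (0:ℝ) 1

/-- `ψ` satisfies an `ε`-Hölder bound with constant `H` on `[0,1]`. -/
def HolderBoundOn01 (ε H : ℝ) (ψ : ℝ → ℝ) : Prop :=
  ∀ x ∈ I01, ∀ y ∈ I01, |ψ x - ψ y| ≤ H * |x - y| ^ ε

/-- A `C^{k+ε}` Cantor system on `[0,1]` with `d` branches: each branch `g i` is a
`C^k` increasing contraction of `[0,1]` with `ε`-Hölder `k`-th derivative, the images
`g i ([0,1])` are disjoint closed intervals in increasing order, `g 0 0 = 0` and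
`g (d-1) 1 = 1`. -/
structure IsCantorSystem {d : ℕ} (k : ℕ) (ε : ℝ) (g : Fin d → ℝ → ℝ) : Prop where
  maps : ∀ i, Set.MapsTo (g i) I01 I01
  smooth : ∀ i, ContDiffOn ℝ k (g i) I01
  holder : ∀ i, ∃ H > 0, HolderBoundOn01 ε H (iteratedDerivWithin k (g i) I01)
  deriv_pos : ∀ i, ∀ x ∈ I01, 0 < derivWithin (g i) I01 x
  deriv_lt_one : ∀ i, ∀ x ∈ I01, derivWithin (g i) I01 x < 1
  ordered : ∀ i j : Fin d, i < j → g i 1 < g j 0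
  first : ∀ i : Fin d, (i : ℕ) = 0 → g i 0 = 0
  last : ∀ i : Fin d, (i : ℕ) = d - 1 → g i 1 = 1

/-- For a finite word `w = [w₁,…,wₙ]`, `wordMap g w = g_{wₙ} ∘ ⋯ ∘ g_{w₁}` (i.e. `G_w`). -/
def wordMap {d : ℕ} (g : Fin d → ℝ → ℝ) : List (Fin d) → ℝ → ℝ
  | [] => id
  | i :: w => fun x => wordMap g w (g i x)

/-- `|I_w|`, the length of the interval `I_w = G_w([0,1]) = [G_w 0, G_w 1]`. -/
def wordLen {d : ℕ} (g : Fin d → ℝ → ℝ) (w : List (Fin d)) : ℝ :=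
  wordMap g w 1 - wordMap g w 0

/-- The scaling data of the word `w`: the first `d` coordinates are the ratios
`|I_{i·w}|/|I_w|`, the last `d-1` coordinates are the `d-1` gap lengths between the
consecutive children `I_{1·w},…,I_{d·w}` divided by `|I_w|`. -/
def scalingData {d : ℕ} (g : Fin d → ℝ → ℝ) (w : List (Fin d)) : Fin (2*d-1) → ℝ :=
  fun m =>
    if h : (m : ℕ) < d then
      wordLen g ((⟨(m : ℕ), h⟩ : Fin d) :: w) / wordLen g w
    else
      (wordMap g w (g ⟨(m : ℕ) - d + 1, by have := m.isLt; omega⟩ 0)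
        - wordMap g w (g ⟨(m : ℕ) - d, by have := m.isLt; omega⟩ 1)) / wordLen g w

/-- The open simplex `Simp_{2d-2} ⊆ (0,1)^{2d-1}` of vectors with coordinate sum `1`. -/
def Simp (d : ℕ) : Set (Fin (2*d-1) → ℝ) :=
  {s | (∀ m, s m ∈ Set.Ioo (0:ℝ) 1) ∧ ∑ m, s m = 1}

/-- The initial word `j|_n = (j_1,…,j_n)` of a sequence `j ∈ Σ_d^dual = {1,…,d}^ℕ`. -/
def dword {d : ℕ} (j : ℕ → Fin d) (n : ℕ) : List (Fin d) :=
  List.ofFn (fun i : Fin n => j i)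

/-- `S` is the scaling function of the system `g`:
`S(j) = lim_{n→∞} S_n(j|_n)` for every `j ∈ Σ_d^dual`. -/
def HasScalingFunction {d : ℕ} (g : Fin d → ℝ → ℝ) (S : (ℕ → Fin d) → Fin (2*d-1) → ℝ) : Prop :=
  ∀ j : ℕ → Fin d,
    Filter.Tendsto (fun n => scalingData g (dword j n)) Filter.atTop (nhds (S j))

/-- `ρ_S(j,j')` where `n = #(j∩j')`:
`ρ_S(j,j') = sup_w ∏_{t=1}^{n} S((j_{t+1},…,j_n)·w)_{j_t}` (depends only on `j` and `n`). -/
def rhoS {d : ℕ} (S : (ℕ → Fin d) → Fin (2*d-1) → ℝ) (j : ℕ → Fin d) (n : ℕ) : ℝ :=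
  ⨆ w : ℕ → Fin d, ∏ t ∈ Finset.range n,
    S (fun m => if t + 1 + m < n then j (t + 1 + m) else w (t + 1 + m - n))
      ⟨((j t) : ℕ), by have := (j t).isLt; omega⟩

/-- Given a scaling vector `s ∈ Simp_{2d-2}`, the partition of `[0,1]` it determines has
`i`-th child interval starting at `childLeft s i = ∑_{m<i} (s_m + s_{d+m})`. -/
def childLeft {d : ℕ} (s : Fin (2*d-1) → ℝ) (i : Fin d) : ℝ :=
  ∑ m ∈ (Finset.range (i : ℕ)).attach,
    (s ⟨(m : ℕ), by have h := Finset.mem_range.mp m.2; have := i.isLt; omega⟩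
      + s ⟨d + (m : ℕ), by have h := Finset.mem_range.mp m.2; have := i.isLt; omega⟩)

/-- The right endpoint of the `i`-th child interval of the partition determined by `s`. -/
def childRight {d : ℕ} (s : Fin (2*d-1) → ℝ) (i : Fin d) : ℝ :=
  childLeft s i + s ⟨(i : ℕ), by have := i.isLt; omega⟩

/-- `A(j)`: the set of `2d` endpoints of the `d` child intervals of the partition of `[0,1]`
determined by the scaling vector `s = S(j)`. -/
def Apts {d : ℕ} (s : Fin (2*d-1) → ℝ) : Set ℝ :=
  ⋃ i : Fin d, {childLeft s i, childRight s i}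

/-- An increasing `C^k` diffeomorphism of `[0,1]`. -/
structure IsDiffeo01 (k : ℕ) (φ : ℝ → ℝ) : Prop where
  smooth : ContDiffOn ℝ k φ I01
  mono : StrictMonoOn φ I01
  deriv_pos : ∀ x ∈ I01, 0 < derivWithin φ I01 x
  bij : Set.BijOn φ I01 I01

/-- `D^k(A₁,A₂)`: increasing `C^k` diffeomorphisms of `[0,1]` mapping `A₁` onto `A₂`. -/
def Dk (k : ℕ) (A₁ A₂ : Set ℝ) : Set (ℝ → ℝ) :=
  {φ | IsDiffeo01 k φ ∧ φ '' A₁ = A₂}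

/-- `D^k_var(M)(A₁,A₂)`: members of `D^k(A₁,A₂)` whose `k`-th derivative has variation `< M`. -/
def DkVar (k : ℕ) (M : ℝ) (A₁ A₂ : Set ℝ) : Set (ℝ → ℝ) :=
  {φ | φ ∈ Dk k A₁ A₂ ∧ ∀ x ∈ I01, ∀ y ∈ I01,
    |iteratedDerivWithin k φ I01 x - iteratedDerivWithin k φ I01 y| < M}

/-- The renormalization `(L')⁻¹ ∘ φ ∘ L` of `φ`, where `L, L'` are the increasing affine
bijections from `[0,1]` onto `[a,b]` and `[a',b']` respectively. -/
def renorm (a b a' b' : ℝ) (φ : ℝ → ℝ) : ℝ → ℝ :=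
  fun x => (φ (a + (b - a) * x) - a') / (b' - a')

/-- `R_{j₀} φ`: restrict `φ` to the `j₀`-th child interval of the partition determined by `s`
(mapped to the `j₀`-th child interval of the partition determined by `s'`) and renormalize. -/
def Rmap {d : ℕ} (s s' : Fin (2*d-1) → ℝ) (j₀ : Fin d) (φ : ℝ → ℝ) : ℝ → ℝ :=
  renorm (childLeft s j₀) (childRight s j₀) (childLeft s' j₀) (childRight s' j₀) φ

/-- `j₀·j = (j₀, j_1, j_2, …)`. -/
def consSeq {d : ℕ} (j₀ : Fin d) (j : ℕ → Fin d) : ℕ → Fin d :=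
  fun m => if m = 0 then j₀ else j (m - 1)

/-- The Cantor set of the system: `C = ⋂_{n ≥ 1} ⋃_{w of length n} I_w`. -/
def systemCantorSet {d : ℕ} (g : Fin d → ℝ → ℝ) : Set ℝ :=
  ⋂ n : ℕ, ⋃ w ∈ {w : List (Fin d) | w.length = n + 1}, wordMap g w '' I01

end

/-- `HolderClass ε K m v`: on `K` the function `v` and its derivatives up to order `m` are bounded,
and the `m`-th derivative is `ε`-Hölder. -/
def HolderClass (ε : ℝ) (K : Set ℝ) : ℕ → (ℝ → ℝ) → Prop
  | 0, v => ∃ C, ∀ x ∈ K, |v x| ≤ C ∧ ∀ y ∈ K, |v x - v y| ≤ C * |x - y| ^ ε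
  | m + 1, v => (∃ C, ∀ x ∈ K, |v x| ≤ C) ∧
      ∃ v' : ℝ → ℝ, (∀ x ∈ K, HasDerivWithinAt v (v' x) K x) ∧ HolderClass ε K m v'

theorem abs_sub_le_of_hasDerivWithinAt {K : Set ℝ} (hK : Convex ℝ K) {v v' : ℝ → ℝ} {C : ℝ}
    (hv : ∀ x ∈ K, HasDerivWithinAt v (v' x) K x) (hC : ∀ x ∈ K, |v' x| ≤ C)
    {x y : ℝ} (hx : x ∈ K) (hy : y ∈ K) : |v x - v y| ≤ C * |x - y| := by
  simpa using hK.norm_image_sub_le_of_norm_hasDerivWithin_le hv hC hy hx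

theorem eq_of_hasDerivWithinAt_eq {K : Set ℝ} (hK : Convex ℝ K) {v w q : ℝ → ℝ}
    (hv : ∀ x ∈ K, HasDerivWithinAt v (q x) K x) (hw : ∀ x ∈ K, HasDerivWithinAt w (q x) K x)
    {a : ℝ} (ha : a ∈ K) (h : v a = w a) {x : ℝ} (hx : x ∈ K) : v x = w x := by
  have := abs_sub_le_of_hasDerivWithinAt hK (v := fun x => v x - w x) (v' := fun _ => 0) (C := 0)
    (fun y hy => by simpa using (hv y hy).fun_sub (hw y hy)) (by simp) hx ha
  simp only [h, sub_self, sub_zero, zero_mul] at this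
  linarith [abs_nonpos_iff.mp this]

theorem exists_hasDerivWithinAt_Icc {a b : ℝ} (hab : a ≤ b) {q : ℝ → ℝ}
    (hq : ContinuousOn q (Icc a b)) (x₀ c : ℝ) :
    ∃ P : ℝ → ℝ, P x₀ = c ∧ ∀ x ∈ Icc a b, HasDerivWithinAt P (q x) (Icc a b) x := by
  have hc : Continuous (IccExtend hab ((Icc a b).domRestrict q)) :=
    (continuousOn_iff_continuous_domRestrict.mp hq).Icc_extend'
  refine ⟨fun x => c + ∫ t in x₀..x, IccExtend hab ((Icc a b).domRestrict q) t, by simp, ?_⟩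
  intro x hx
  have h := (hc.integral_hasStrictDerivAt x₀ x).hasDerivAt.const_add c
  rw [IccExtend_of_mem _ _ hx] at h
  exact h.hasDerivWithinAt

namespace HolderClass

variable {ε : ℝ} {K : Set ℝ} {m : ℕ} {v w : ℝ → ℝ}

theorem bounded (h : HolderClass ε K m v) : ∃ C, 0 ≤ C ∧ ∀ x ∈ K, |v x| ≤ C := by
  obtain ⟨C, hC⟩ : ∃ C, ∀ x ∈ K, |v x| ≤ C := by
    cases m with
    | zero => obtain ⟨C, hC⟩ := h; exact ⟨C, fun x hx => (hC x hx).1⟩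
    | succ m => exact h.1
  exact ⟨|C|, abs_nonneg C, fun x hx => (hC x hx).trans (le_abs_self C)⟩

theorem exists_holder (h : HolderClass ε K 0 v) :
    ∃ C, 0 ≤ C ∧ (∀ x ∈ K, |v x| ≤ C) ∧ ∀ x ∈ K, ∀ y ∈ K, |v x - v y| ≤ C * |x - y| ^ ε := by
  obtain ⟨C, hC⟩ := h
  refine ⟨|C|, abs_nonneg C, fun x hx => (hC x hx).1.trans (le_abs_self C), fun x hx y hy => ?_⟩
  exact ((hC x hx).2 y hy).trans
    (mul_le_mul_of_nonneg_right (le_abs_self C) (Real.rpow_nonneg (abs_nonneg _) _))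

theorem of_holder {B C : ℝ} (hB : ∀ x ∈ K, |v x| ≤ B)
    (hC : ∀ x ∈ K, ∀ y ∈ K, |v x - v y| ≤ C * |x - y| ^ ε) : HolderClass ε K 0 v :=
  ⟨max B C, fun x hx => ⟨(hB x hx).trans (le_max_left _ _), fun y hy => (hC x hx y hy).trans
    (mul_le_mul_of_nonneg_right (le_max_right _ _) (Real.rpow_nonneg (abs_nonneg _) _))⟩⟩

theorem of_lipschitz (hε : 0 < ε) (hε1 : ε ≤ 1) {B L : ℝ} (hB : ∀ x ∈ K, |v x| ≤ B)
    (hL : ∀ x ∈ K, ∀ y ∈ K, |v x - v y| ≤ L * |x - y|) : HolderClass ε K 0 v := by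
  refine of_holder (C := |L| + 2 * |B|) hB fun x hx y hy => ?_
  rcases le_total |x - y| 1 with h | h
  · have h1 : |x - y| ≤ |x - y| ^ ε := by
      simpa using Real.rpow_le_rpow_of_exponent_ge_of_imp (abs_nonneg (x - y)) h hε1
        (fun _ h0 => absurd h0 one_ne_zero)
    calc |v x - v y| ≤ L * |x - y| := hL x hx y hy
      _ ≤ |L| * |x - y| := by gcongr; exact le_abs_self L
      _ ≤ (|L| + 2 * |B|) * |x - y| ^ ε := by
        gcongr; linarith [abs_nonneg B]
  · have h1 : 1 ≤ |x - y| ^ ε := Real.one_le_rpow h hε.le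
    calc |v x - v y| ≤ |v x| + |v y| := abs_sub _ _
      _ ≤ 2 * |B| := by linarith [hB x hx, hB y hy, le_abs_self B]
      _ ≤ (|L| + 2 * |B|) * 1 := by linarith [abs_nonneg L]
      _ ≤ _ := by gcongr

theorem congr (h : HolderClass ε K m v) (hvw : ∀ x ∈ K, w x = v x) : HolderClass ε K m w := by
  cases m with
  | zero =>
    obtain ⟨C, -, hB, hC⟩ := h.exists_holder
    exact of_holder (B := C) (C := C) (fun x hx => by rw [hvw x hx]; exact hB x hx)
      fun x hx y hy => by rw [hvw x hx, hvw y hy]; exact hC x hx y hy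
  | succ m =>
    obtain ⟨⟨B, hB⟩, v', hv', h⟩ := h
    exact ⟨⟨B, fun x hx => by rw [hvw x hx]; exact hB x hx⟩, v',
      fun x hx => (hv' x hx).congr hvw (hvw x hx), h⟩

theorem of_succ (hε : 0 < ε) (hε1 : ε ≤ 1) (hK : Convex ℝ K) (h : HolderClass ε K (m + 1) v) :
    HolderClass ε K m v := by
  induction m generalizing v with
  | zero =>
    obtain ⟨⟨B, hB⟩, v', hv', h⟩ := h
    obtain ⟨C, -, hC⟩ := h.bounded
    exact of_lipschitz hε hε1 hB fun x hx y hy => abs_sub_le_of_hasDerivWithinAt hK hv' hC hx hy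
  | succ m ih =>
    obtain ⟨hB, v', hv', h⟩ := h
    exact ⟨hB, v', hv', ih h⟩

theorem of_le (hε : 0 < ε) (hε1 : ε ≤ 1) (hK : Convex ℝ K) {n : ℕ} (hmn : m ≤ n)
    (h : HolderClass ε K n v) : HolderClass ε K m v := by
  induction hmn with
  | refl => exact h
  | step _ ih => exact ih (h.of_succ hε hε1 hK)

theorem continuousOn (hε : 0 < ε) (hε1 : ε ≤ 1) (hK : Convex ℝ K) (h : HolderClass ε K m v) :
    ContinuousOn v K := by
  obtain ⟨C, -, -, hC⟩ := (h.of_le hε hε1 hK (Nat.zero_le m)).exists_holder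
  intro x hx
  rw [ContinuousWithinAt, tendsto_iff_norm_sub_tendsto_zero]
  have h0 : Tendsto (fun y => C * |y - x| ^ ε) (nhdsWithin x K) (nhds 0) := by
    have : Continuous fun y : ℝ => C * |y - x| ^ ε :=
      continuous_const.mul ((continuous_id.sub continuous_const).abs.rpow_const
        fun _ => Or.inr hε.le)
    simpa [Real.zero_rpow hε.ne'] using (this.tendsto x).mono_left nhdsWithin_le_nhds
  exact squeeze_zero' (Eventually.of_forall fun _ => norm_nonneg _)
    (eventually_nhdsWithin_of_forall fun y hy => hC y hy x hx) h0

theorem const (c : ℝ) : HolderClass ε K m fun _ => c := by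
  induction m generalizing c with
  | zero => exact of_holder (B := |c|) (C := 0) (fun _ _ => le_rfl) (by simp)
  | succ m ih =>
    exact ⟨⟨|c|, fun _ _ => le_rfl⟩, fun _ => 0, fun x _ => hasDerivWithinAt_const x K c, ih 0⟩

theorem add (hv : HolderClass ε K m v) (hw : HolderClass ε K m w) :
    HolderClass ε K m fun x => v x + w x := by
  induction m generalizing v w with
  | zero =>
    obtain ⟨C, -, hB, hC⟩ := hv.exists_holder
    obtain ⟨D, -, hB', hD⟩ := hw.exists_holder
    refine of_holder (B := C + D) (C := C + D)
      (fun x hx => (abs_add_le _ _).trans (add_le_add (hB x hx) (hB' x hx))) fun x hx y hy => ?_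
    calc |v x + w x - (v y + w y)| = |(v x - v y) + (w x - w y)| := by ring_nf
      _ ≤ |v x - v y| + |w x - w y| := abs_add_le _ _
      _ ≤ (C + D) * |x - y| ^ ε := by rw [add_mul]; exact add_le_add (hC x hx y hy) (hD x hx y hy)
  | succ m ih =>
    obtain ⟨⟨B, hB⟩, v', hv', h⟩ := hv
    obtain ⟨⟨B', hB'⟩, w', hw', h'⟩ := hw
    exact ⟨⟨B + B', fun x hx => (abs_add_le _ _).trans (add_le_add (hB x hx) (hB' x hx))⟩,
      fun x => v' x + w' x, fun x hx => (hv' x hx).fun_add (hw' x hx), ih h h'⟩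

theorem mul (hε : 0 < ε) (hε1 : ε ≤ 1) (hK : Convex ℝ K)
    (hv : HolderClass ε K m v) (hw : HolderClass ε K m w) :
    HolderClass ε K m fun x => v x * w x := by
  induction m generalizing v w with
  | zero =>
    obtain ⟨C, hC0, hB, hC⟩ := hv.exists_holder
    obtain ⟨D, hD0, hB', hD⟩ := hw.exists_holder
    refine of_holder (B := C * D) (C := 2 * (C * D))
      (fun x hx => by rw [abs_mul]; gcongr; exacts [hB x hx, hB' x hx]) fun x hx y hy => ?_
    calc |v x * w x - v y * w y| = |(v x - v y) * w x + v y * (w x - w y)| := by ring_nf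
      _ ≤ |v x - v y| * |w x| + |v y| * |w x - w y| := by
        rw [← abs_mul, ← abs_mul]; exact abs_add_le _ _
      _ ≤ (C * |x - y| ^ ε) * D + C * (D * |x - y| ^ ε) := by
        gcongr
        exacts [hC x hx y hy, hB' x hx, hB y hy, hD x hx y hy]
      _ = 2 * (C * D) * |x - y| ^ ε := by ring
  | succ m ih =>
    have hv₀ := hv.of_succ hε hε1 hK
    have hw₀ := hw.of_succ hε hε1 hK
    obtain ⟨B, hB0, hB⟩ := hv.bounded
    obtain ⟨B', hB0', hB'⟩ := hw.bounded
    obtain ⟨-, v', hv', h⟩ := hv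
    obtain ⟨-, w', hw', h'⟩ := hw
    exact ⟨⟨B * B', fun x hx => by rw [abs_mul]; gcongr; exacts [hB x hx, hB' x hx]⟩,
      fun x => v' x * w x + v x * w' x, fun x hx => (hv' x hx).fun_mul (hw' x hx),
      (ih h hw₀).add (ih hv₀ h')⟩

theorem comp (hε : 0 < ε) (hε1 : ε ≤ 1) {T : Set ℝ} (hT : Convex ℝ T)
    {χ : ℝ → ℝ} {L : ℝ} (hL : ∀ x ∈ T, ∀ y ∈ T, |χ x - χ y| ≤ L * |x - y|)
    (hmaps : MapsTo χ T K) (hv : HolderClass ε K m v) (hχ : HolderClass ε T m χ) :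
    HolderClass ε T m fun x => v (χ x) := by
  induction m generalizing v with
  | zero =>
    obtain ⟨C, hC0, hB, hC⟩ := hv.exists_holder
    refine of_holder (B := C) (C := C * |L| ^ ε) (fun x hx => hB _ (hmaps hx)) fun x hx y hy => ?_
    calc |v (χ x) - v (χ y)| ≤ C * |χ x - χ y| ^ ε := hC _ (hmaps hx) _ (hmaps hy)
      _ ≤ C * (|L| * |x - y|) ^ ε := by
        gcongr
        exact (hL x hx y hy).trans (by gcongr; exact le_abs_self L)
      _ = C * |L| ^ ε * |x - y| ^ ε := by
        rw [Real.mul_rpow (abs_nonneg _) (abs_nonneg _), mul_assoc]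
  | succ m ih =>
    have hχ₀ := hχ.of_succ hε hε1 hT
    obtain ⟨⟨B, hB⟩, v', hv', h⟩ := hv
    obtain ⟨-, χ', hχ', h'⟩ := hχ
    exact ⟨⟨B, fun x hx => hB _ (hmaps hx)⟩, fun x => v' (χ x) * χ' x,
      fun x hx => (hv' _ (hmaps hx)).comp x (hχ' x hx) hmaps, mul hε hε1 hT (ih h hχ₀) h'⟩

theorem exp (hε : 0 < ε) (hε1 : ε ≤ 1) (hK : Convex ℝ K) (hv : HolderClass ε K m v) :
    HolderClass ε K m fun x => Real.exp (v x) := by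
  obtain ⟨B, -, hB⟩ := hv.bounded
  have hb : ∀ x ∈ K, |Real.exp (v x)| ≤ Real.exp B := fun x hx => by
    rw [Real.abs_exp]; exact Real.exp_le_exp.mpr ((le_abs_self _).trans (hB x hx))
  induction m with
  | zero =>
    obtain ⟨C, hC0, -, hC⟩ := hv.exists_holder
    refine of_holder (C := Real.exp B * C) hb fun x hx y hy => ?_
    have h := abs_sub_le_of_hasDerivWithinAt (convex_Icc (-B) B) (v := Real.exp) (v' := Real.exp)
      (C := Real.exp B) (fun t _ => (Real.hasDerivAt_exp t).hasDerivWithinAt)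
      (fun t ht => by rw [Real.abs_exp]; exact Real.exp_le_exp.mpr ht.2)
      (abs_le.mp (hB x hx)) (abs_le.mp (hB y hy))
    rw [mul_assoc]
    exact h.trans (by gcongr; exact hC x hx y hy)
  | succ m ih =>
    have hv₀ := hv.of_succ hε hε1 hK
    obtain ⟨-, v', hv', h⟩ := hv
    exact ⟨⟨_, hb⟩, fun x => Real.exp (v x) * v' x, fun x hx => (hv' x hx).exp,
      mul hε hε1 hK (ih hv₀) h⟩

theorem log (hε : 0 < ε) (hε1 : ε ≤ 1) (hK : Convex ℝ K) {a : ℝ} (ha : 0 < a)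
    (hav : ∀ x ∈ K, a ≤ v x) (hv : HolderClass ε K m v) :
    HolderClass ε K m fun x => Real.log (v x) := by
  obtain ⟨B, -, hB⟩ := hv.bounded
  have hb : ∀ x ∈ K, |Real.log (v x)| ≤ |Real.log a| + |Real.log B| := fun x hx => by
    have h1 := Real.log_le_log ha (hav x hx)
    have h2 := Real.log_le_log (ha.trans_le (hav x hx)) ((le_abs_self _).trans (hB x hx))
    rw [abs_le]
    constructor <;> linarith [neg_abs_le (Real.log a), le_abs_self (Real.log B),
      abs_nonneg (Real.log a), abs_nonneg (Real.log B)]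
  induction m with
  | zero =>
    obtain ⟨C, hC0, -, hC⟩ := hv.exists_holder
    refine of_holder (C := a⁻¹ * C) hb fun x hx y hy => ?_
    have h := abs_sub_le_of_hasDerivWithinAt (convex_Ici a) (v := Real.log) (v' := fun t => t⁻¹)
      (C := a⁻¹) (fun t ht => (Real.hasDerivAt_log (ha.trans_le ht).ne').hasDerivWithinAt)
      (fun t ht => by
        rw [abs_of_pos (inv_pos.mpr (ha.trans_le ht))]
        exact inv_anti₀ ha ht)
      (hav x hx) (hav y hy)
    rw [mul_assoc]
    exact h.trans (by gcongr; exact hC x hx y hy)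
  | succ m ih =>
    have hv₀ := hv.of_succ hε hε1 hK
    have he := exp hε hε1 hK (mul hε hε1 hK (const (-1)) (ih hv₀))
    obtain ⟨-, v', hv', h⟩ := hv
    refine ⟨⟨_, hb⟩, fun x => v' x * Real.exp (-1 * Real.log (v x)), fun x hx => ?_,
      mul hε hε1 hK h he⟩
    have hpos := ha.trans_le (hav x hx)
    have := (hv' x hx).log hpos.ne'
    simpa only [neg_one_mul, Real.exp_neg, Real.exp_log hpos, ← div_eq_mul_inv] using this

theorem of_contDiffOn {a b : ℝ} (hab : a < b)
    (hv : ContDiffOn ℝ m v (Icc a b)) {H : ℝ}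
    (hH : ∀ x ∈ Icc a b, ∀ y ∈ Icc a b, |iteratedDerivWithin m v (Icc a b) x
      - iteratedDerivWithin m v (Icc a b) y| ≤ H * |x - y| ^ ε) :
    HolderClass ε (Icc a b) m v := by
  induction m generalizing v with
  | zero =>
    obtain ⟨B, hB⟩ := isCompact_Icc.exists_bound_of_continuousOn hv.continuousOn
    exact of_holder hB (by simpa using hH)
  | succ m ih =>
    obtain ⟨B, hB⟩ := isCompact_Icc.exists_bound_of_continuousOn hv.continuousOn
    have h := (contDiffOn_succ_iff_derivWithin (n := (m : WithTop ℕ∞))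
      (uniqueDiffOn_Icc hab)).mp (by exact_mod_cast hv)
    refine ⟨⟨B, hB⟩, derivWithin v (Icc a b), fun x hx => (h.1 x hx).hasDerivWithinAt,
      ih h.2.2 ?_⟩
    simpa only [iteratedDerivWithin_succ'] using hH

theorem of_hasCompactSupport (hε : 0 < ε) (hε1 : ε ≤ 1) (hv : ContDiff ℝ (⊤ : ℕ∞) v)
    (hs : HasCompactSupport v) : HolderClass ε univ m v := by
  induction m generalizing v with
  | zero =>
    obtain ⟨B, hB⟩ := hs.exists_bound_of_continuous hv.continuous
    have hd := (contDiff_infty_iff_deriv.mp hv)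
    obtain ⟨L, hL⟩ := hs.deriv.exists_bound_of_continuous hd.2.continuous
    refine of_lipschitz hε hε1 (fun x _ => hB x) fun x _ y _ =>
      abs_sub_le_of_hasDerivWithinAt convex_univ
        (fun t _ => (hd.1 t).hasDerivAt.hasDerivWithinAt) (fun t _ => hL t) trivial trivial
  | succ m ih =>
    obtain ⟨B, hB⟩ := hs.exists_bound_of_continuous hv.continuous
    have hd := (contDiff_infty_iff_deriv.mp hv)
    exact ⟨⟨B, fun x _ => hB x⟩, deriv v, fun x _ => (hd.1 x).hasDerivAt.hasDerivWithinAt,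
      ih hd.2 hs.deriv⟩

theorem contDiff (hε : 0 < ε) (hε1 : ε ≤ 1) (h : HolderClass ε univ m v) :
    ContDiff ℝ m v ∧ ∃ H > 0, ∀ x y, |iteratedDeriv m v x - iteratedDeriv m v y| ≤ H * |x - y| ^ ε := by
  induction m generalizing v with
  | zero =>
    have hc := continuousOn_univ.mp (h.continuousOn hε hε1 convex_univ)
    obtain ⟨C, hC0, -, hC⟩ := h.exists_holder
    refine ⟨contDiff_zero.mpr hc, C + 1, by linarith, fun x y => ?_⟩
    simp only [iteratedDeriv_zero]
    exact (hC x trivial y trivial).trans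
      (mul_le_mul_of_nonneg_right (by linarith) (Real.rpow_nonneg (abs_nonneg _) _))
  | succ m ih =>
    obtain ⟨-, v', hv', h⟩ := h
    have hd : ∀ x, HasDerivAt v (v' x) x := fun x => by simpa using hv' x trivial
    have he : deriv v = v' := funext fun x => (hd x).deriv
    obtain ⟨h1, h2⟩ := ih h
    refine ⟨?_, by simpa only [iteratedDeriv_succ', he] using h2⟩
    push_cast
    rw [contDiff_succ_iff_deriv]
    exact ⟨fun x => (hd x).differentiableAt, by simp, by rwa [he]⟩

theorem exists_extension (hε : 0 < ε) (hε1 : ε ≤ 1) {a b A B : ℝ} (hab : a ≤ b) (hA : A ≤ a)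
    (hB : b ≤ B) (h : HolderClass ε (Icc a b) m v) :
    ∃ w, HolderClass ε (Icc A B) m w ∧ ∀ x ∈ Icc a b, w x = v x := by
  induction m generalizing v with
  | zero =>
    obtain ⟨C, hC0, hB, hC⟩ := h.exists_holder
    refine ⟨fun x => v (projIcc a b hab x), of_holder (B := C) (C := C)
      (fun x _ => hB _ (projIcc a b hab x).2) fun x _ y _ => ?_,
      fun x hx => by simp only [projIcc_of_mem hab hx]⟩
    refine (hC _ (projIcc a b hab x).2 _ (projIcc a b hab y).2).trans ?_
    exact mul_le_mul_of_nonneg_left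
      (Real.rpow_le_rpow (abs_nonneg _) (abs_projIcc_sub_projIcc hab) hε.le) hC0
  | succ m ih =>
    obtain ⟨-, v', hv', h⟩ := h
    obtain ⟨w', hw', hwv⟩ := ih h
    obtain ⟨P, hPa, hP⟩ := exists_hasDerivWithinAt_Icc (hA.trans (hab.trans hB))
      (hw'.continuousOn hε hε1 (convex_Icc _ _)) a (v a)
    have hPc : ContinuousOn P (Icc A B) := fun x hx => (hP x hx).continuousWithinAt
    refine ⟨P, ⟨isCompact_Icc.exists_bound_of_continuousOn hPc, w', hP, hw'⟩, fun x hx => ?_⟩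
    refine eq_of_hasDerivWithinAt_eq (convex_Icc a b) (fun y hy => ?_) hv' (left_mem_Icc.mpr hab)
      hPa hx
    rw [← hwv y hy]
    exact (hP y (Icc_subset_Icc hA hB hy)).mono (Icc_subset_Icc hA hB)

end HolderClass

section Linearization

variable {ε θ : ℝ} {f : ℝ → ℝ}

theorem abs_iterate_sub_iterate_le (hmaps : MapsTo f I01 I01) (hθ : 0 ≤ θ)
    (hL : ∀ x ∈ I01, ∀ y ∈ I01, |f x - f y| ≤ θ * |x - y|) (n : ℕ) {x y : ℝ}
    (hx : x ∈ I01) (hy : y ∈ I01) : |f^[n] x - f^[n] y| ≤ θ ^ n * |x - y| := by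
  induction n with
  | zero => simp
  | succ n ih =>
    rw [Function.iterate_succ_apply', Function.iterate_succ_apply', pow_succ', mul_assoc]
    exact (hL _ (hmaps.iterate n hx) _ (hmaps.iterate n hy)).trans
      (mul_le_mul_of_nonneg_left ih hθ)

theorem tendsto_iterate_zero (hmaps : MapsTo f I01 I01) (hf0 : f 0 = 0) (hθ : 0 ≤ θ) (hθ1 : θ < 1)
    (hL : ∀ x ∈ I01, ∀ y ∈ I01, |f x - f y| ≤ θ * |x - y|) {x : ℝ} (hx : x ∈ I01) :
    Tendsto (fun n => f^[n] x) atTop (nhdsWithin 0 I01) := by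
  refine tendsto_nhdsWithin_iff.mpr ⟨?_, Eventually.of_forall fun n => hmaps.iterate n hx⟩
  rw [tendsto_zero_iff_norm_tendsto_zero]
  refine squeeze_zero (g := fun n => θ ^ n * |x|) (fun _ => norm_nonneg _) (fun n => ?_) ?_
  · have := abs_iterate_sub_iterate_le hmaps hθ hL n hx (y := 0) ⟨le_rfl, zero_le_one⟩
    rwa [Function.iterate_fixed hf0, sub_zero, sub_zero] at this
  · simpa using (tendsto_pow_atTop_nhds_zero_of_lt_one hθ hθ1).mul_const |x|

theorem eq_of_cohomologous (hmaps : MapsTo f I01 I01) (hf0 : f 0 = 0) (hθ : 0 ≤ θ) (hθ1 : θ < 1)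
    (hL : ∀ x ∈ I01, ∀ y ∈ I01, |f x - f y| ≤ θ * |x - y|) {p q φ : ℝ → ℝ}
    (hp : ContinuousOn p I01) (hq : ContinuousOn q I01) (h0 : p 0 = q 0)
    (hpf : ∀ x ∈ I01, p x = φ x + p (f x)) (hqf : ∀ x ∈ I01, q x = φ x + q (f x))
    {x : ℝ} (hx : x ∈ I01) : p x = q x := by
  have hn : ∀ n : ℕ, p (f^[n] x) - q (f^[n] x) = p x - q x := by
    intro n
    induction n with
    | zero => rfl
    | succ n ih =>
      rw [Function.iterate_succ_apply', ← ih, hpf _ (hmaps.iterate n hx),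
        hqf _ (hmaps.iterate n hx)]
      ring
  have hlim := ((hp.sub hq) 0 ⟨le_rfl, zero_le_one⟩).tendsto.comp
    (tendsto_iterate_zero hmaps hf0 hθ hθ1 hL hx)
  have hconst : ((p - q) ∘ fun n => f^[n] x) = fun _ => p x - q x := funext hn
  rw [hconst] at hlim
  have := tendsto_nhds_unique hlim tendsto_const_nhds
  simp only [Pi.sub_apply, h0, sub_self] at this
  linarith

theorem exists_holder_solution (hε : 0 < ε) (hmaps : MapsTo f I01 I01) (hf0 : f 0 = 0)
    (hθ : 0 ≤ θ) (hθ1 : θ < 1) (hL : ∀ x ∈ I01, ∀ y ∈ I01, |f x - f y| ≤ θ * |x - y|)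
    {ψ : ℝ → ℝ} (hψ : HolderClass ε I01 0 ψ) {μ c : ℝ} (hμ : 0 ≤ μ) (hμ1 : μ ≤ 1)
    (hc : c = ψ 0 + μ * c) :
    ∃ p, HolderClass ε I01 0 p ∧ p 0 = c ∧ ∀ x ∈ I01, p x = ψ x + μ * p (f x) := by
  obtain ⟨C, hC0, -, hC⟩ := hψ.exists_holder
  have h0 : (0 : ℝ) ∈ I01 := ⟨le_rfl, zero_le_one⟩
  have hr : θ ^ ε < 1 := Real.rpow_lt_one hθ hθ1 hε
  have hr0 : 0 ≤ θ ^ ε := Real.rpow_nonneg hθ ε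
  have hterm : ∀ n, ∀ x ∈ I01, ∀ y ∈ I01,
      |μ ^ n * (ψ (f^[n] x) - ψ (f^[n] y))| ≤ (θ ^ ε) ^ n * (C * |x - y| ^ ε) := by
    intro n x hx y hy
    rw [abs_mul, abs_of_nonneg (pow_nonneg hμ n)]
    calc μ ^ n * |ψ (f^[n] x) - ψ (f^[n] y)|
        ≤ 1 * (C * |f^[n] x - f^[n] y| ^ ε) := by
          gcongr
          exacts [pow_le_one₀ hμ hμ1, hC _ (hmaps.iterate n hx) _ (hmaps.iterate n hy)]
      _ ≤ 1 * (C * (θ ^ n * |x - y|) ^ ε) := by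
          gcongr
          exact abs_iterate_sub_iterate_le hmaps hθ hL n hx hy
      _ = (θ ^ ε) ^ n * (C * |x - y| ^ ε) := by
          rw [Real.mul_rpow (pow_nonneg hθ n) (abs_nonneg _), ← Real.rpow_natCast,
            ← Real.rpow_natCast, ← Real.rpow_mul hθ, ← Real.rpow_mul hθ, mul_comm (n : ℝ)]
          ring
  have hgeom := summable_geometric_of_lt_one hr0 hr
  have hsum : ∀ x ∈ I01, Summable fun n => μ ^ n * (ψ (f^[n] x) - ψ 0) := fun x hx =>
    Summable.of_norm_bounded (hgeom.mul_right (C * |x - 0| ^ ε)) fun n => by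
      simpa only [Function.iterate_fixed hf0, Real.norm_eq_abs] using hterm n x hx 0 h0
  have hdiff : ∀ x ∈ I01, ∀ y ∈ I01,
      |(c + ∑' n, μ ^ n * (ψ (f^[n] x) - ψ 0)) - (c + ∑' n, μ ^ n * (ψ (f^[n] y) - ψ 0))|
        ≤ (1 - θ ^ ε)⁻¹ * C * |x - y| ^ ε := by
    intro x hx y hy
    rw [add_sub_add_left_eq_sub, ← (hsum x hx).tsum_sub (hsum y hy), mul_assoc]
    refine tsum_of_norm_bounded (f := fun n => μ ^ n * (ψ (f^[n] x) - ψ 0) -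
      μ ^ n * (ψ (f^[n] y) - ψ 0))
      ((hasSum_geometric_of_lt_one hr0 hr).mul_right (C * |x - y| ^ ε)) fun n => ?_
    rw [← mul_sub, sub_sub_sub_cancel_right]
    exact hterm n x hx y hy
  refine ⟨fun x => c + ∑' n, μ ^ n * (ψ (f^[n] x) - ψ 0), ?_, ?_, ?_⟩
  · refine HolderClass.of_holder (B := |c| + (1 - θ ^ ε)⁻¹ * C) (fun x hx => ?_) hdiff
    have h := hdiff x hx 0 h0
    have h1 : |x - 0| ^ ε ≤ 1 := by
      rw [sub_zero, abs_of_nonneg hx.1]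
      exact Real.rpow_le_one hx.1 hx.2 hε.le
    have h2 : 0 ≤ (1 - θ ^ ε)⁻¹ * C := mul_nonneg (inv_nonneg.mpr (by linarith)) hC0
    simp only [Function.iterate_fixed hf0, sub_self, mul_zero, tsum_zero, add_zero] at h
    have h3 := abs_sub_abs_le_abs_sub (c + ∑' n, μ ^ n * (ψ (f^[n] x) - ψ 0)) c
    have h4 := mul_le_mul_of_nonneg_left h1 h2
    linarith
  · simp [Function.iterate_fixed hf0]
  · intro x hx
    simp only
    rw [(hsum x hx).tsum_eq_zero_add]
    simp only [Function.iterate_succ_apply, pow_succ', mul_assoc, tsum_mul_left,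
      Function.iterate_zero, id, pow_zero, one_mul]
    linear_combination hc

theorem exists_smooth_solution (hε : 0 < ε) (hε1 : ε ≤ 1) (hmaps : MapsTo f I01 I01)
    (hf0 : f 0 = 0) (hθ : 0 ≤ θ) (hθ1 : θ < 1)
    (hL : ∀ x ∈ I01, ∀ y ∈ I01, |f x - f y| ≤ θ * |x - y|)
    {f' u : ℝ → ℝ} (hf : ∀ x ∈ I01, HasDerivWithinAt f (f' x) I01 x)
    (hpos : 0 < f' 0) (hlt : f' 0 < 1)
    (hfu : ∀ x ∈ I01, f' x * Real.exp (u (f x)) = f' 0 * Real.exp (u x))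
    {m : ℕ} (hu : ∀ n < m, HolderClass ε I01 n u)
    {ψ : ℝ → ℝ} (hψ : HolderClass ε I01 m ψ) {μ c : ℝ} (hμ : 0 ≤ μ) (hμ1 : μ ≤ 1)
    (hc : c = ψ 0 + μ * c) :
    ∃ p, HolderClass ε I01 m p ∧ p 0 = c ∧ ∀ x ∈ I01, p x = ψ x + μ * p (f x) := by
  have hI : Convex ℝ I01 := convex_Icc 0 1
  have h0 : (0 : ℝ) ∈ I01 := ⟨le_rfl, zero_le_one⟩
  induction m generalizing ψ μ c with
  | zero => exact exists_holder_solution hε hmaps hf0 hθ hθ1 hL hψ hμ hμ1 hc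
  | succ m ih =>
    have hum := hu m (Nat.lt_succ_self m)
    obtain ⟨-, ψ', hψ', h⟩ := hψ
    have hμl : μ * f' 0 < 1 := by nlinarith
    obtain ⟨q, hq, -, hqf⟩ := ih (fun n hn => hu n (hn.trans (Nat.lt_succ_self m)))
      (h.mul hε hε1 hI (((HolderClass.const (-1)).mul hε hε1 hI hum).exp hε hε1 hI))
      (mul_nonneg hμ hpos.le) hμl.le
      (c := (ψ' 0 * Real.exp (-1 * u 0)) / (1 - μ * f' 0)) (by
        have : 1 - μ * f' 0 ≠ 0 := by linarith
        field_simp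
        ring)
    have hqe := hq.mul hε hε1 hI (hum.exp hε hε1 hI)
    obtain ⟨p, hp0, hp⟩ := exists_hasDerivWithinAt_Icc zero_le_one
      (hqe.continuousOn hε hε1 hI) 0 c
    have hpc : ContinuousOn p I01 := fun x hx => (hp x hx).continuousWithinAt
    refine ⟨p, ⟨isCompact_Icc.exists_bound_of_continuousOn hpc, _, hp, hqe⟩, hp0, fun x hx => ?_⟩
    refine eq_of_hasDerivWithinAt_eq (w := fun x => ψ x + μ * p (f x)) hI hp (fun y hy => ?_) h0
      (by simp only [hf0, hp0]; exact hc) hx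
    have hd := (hψ' y hy).fun_add
      (((hp (f y) (hmaps hy)).comp y (hf y hy) hmaps).const_mul μ)
    refine hd.congr_deriv ?_
    have he : Real.exp (-1 * u y) * Real.exp (u y) = 1 := by
      rw [← Real.exp_add]; simp
    rw [hqf y hy]
    linear_combination μ * q (f y) * hfu y hy - ψ' y * he

theorem exists_log_linearizer (hε : 0 < ε) (hε1 : ε ≤ 1) (hmaps : MapsTo f I01 I01)
    (hf0 : f 0 = 0) (hθ : 0 ≤ θ) (hθ1 : θ < 1)
    (hL : ∀ x ∈ I01, ∀ y ∈ I01, |f x - f y| ≤ θ * |x - y|)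
    {f' : ℝ → ℝ} (hf : ∀ x ∈ I01, HasDerivWithinAt f (f' x) I01 x)
    {a : ℝ} (ha : 0 < a) (hpos : ∀ x ∈ I01, a ≤ f' x) (hlt : f' 0 < 1)
    {m : ℕ} (hf' : HolderClass ε I01 m f') :
    ∃ u, HolderClass ε I01 m u ∧ u 0 = 0 ∧
      ∀ x ∈ I01, f' x * Real.exp (u (f x)) = f' 0 * Real.exp (u x) := by
  have hI : Convex ℝ I01 := convex_Icc 0 1
  have h0 : (0 : ℝ) ∈ I01 := ⟨le_rfl, zero_le_one⟩
  have hφ : HolderClass ε I01 m fun x => Real.log (f' x) + -Real.log (f' 0) :=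
    (hf'.log hε hε1 hI ha hpos).add (HolderClass.const _)
  have hp : ∀ x ∈ I01, 0 < f' x := fun x hx => ha.trans_le (hpos x hx)
  obtain ⟨u, hu, hu0, huf⟩ := exists_holder_solution hε hmaps hf0 hθ hθ1 hL
    (hφ.of_le hε hε1 hI (Nat.zero_le m)) zero_le_one le_rfl (c := 0) (by simp)
  simp only [one_mul] at huf
  have hfu : ∀ x ∈ I01, f' x * Real.exp (u (f x)) = f' 0 * Real.exp (u x) := fun x hx => by
    rw [huf x hx, Real.exp_add, Real.exp_add, Real.exp_neg, Real.exp_log (hp x hx),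
      Real.exp_log (hp 0 h0)]
    field_simp [(hp 0 h0).ne']
  have key : ∀ n ≤ m, HolderClass ε I01 n u := by
    intro n
    induction n with
    | zero => exact fun _ => hu
    | succ n ih =>
      intro hn
      have hun := ih (by omega)
      obtain ⟨p, hpn, hp0, hpf⟩ := exists_smooth_solution hε hε1 hmaps hf0 hθ hθ1 hL hf (hp 0 h0) hlt
        hfu (fun j hj => hun.of_le hε hε1 hI (Nat.lt_succ_iff.mp hj))
        (hφ.of_le hε hε1 hI hn) zero_le_one le_rfl (c := 0) (by simp)
      simp only [one_mul] at hpf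
      exact hpn.congr fun x hx => eq_of_cohomologous hmaps hf0 hθ hθ1 hL
        (hu.continuousOn hε hε1 hI) (hpn.continuousOn hε hε1 hI) (hu0.trans hp0.symm) huf hpf hx
  exact ⟨u, key m le_rfl, hu0, hfu⟩

end Linearization

theorem exists_increasing_primitive {E : ℝ → ℝ} (hE : Continuous E) {a : ℝ} (ha : 0 < a)
    (haE : ∀ x, a ≤ E x) :
    ∃ P : ℝ → ℝ, P 0 = 0 ∧ (∀ x, HasDerivAt P (E x) x) ∧ StrictMono P ∧ Function.Bijective P := by
  have hd : ∀ x, HasDerivAt (fun x => ∫ t in (0 : ℝ)..x, E t) (E x) x := fun x =>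
    (hE.integral_hasStrictDerivAt 0 x).hasDerivAt
  have h0 : (fun x => ∫ t in (0 : ℝ)..x, E t) 0 = 0 := by simp
  generalize (fun x => ∫ t in (0 : ℝ)..x, E t) = P at hd h0
  have hmono : StrictMono P := strictMono_of_deriv_pos fun x => by
    rw [(hd x).deriv]; exact ha.trans_le (haE x)
  have hsub : Monotone fun x => P x - a * x :=
    monotone_of_deriv_nonneg (fun x => ((hd x).differentiableAt.sub (by fun_prop)))
      fun x => by
        rw [((hd x).fun_sub ((hasDerivAt_id' x).const_mul a)).deriv]
        linarith [haE x]
  have hcont : Continuous P := continuous_iff_continuousAt.mpr fun x => (hd x).continuousAt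
  have htop : Tendsto P atTop atTop := by
    refine tendsto_atTop_mono' _ ?_ (tendsto_id.const_mul_atTop ha)
    filter_upwards [eventually_ge_atTop 0] with x hx
    have := hsub hx
    simp only [h0, mul_zero, sub_zero] at this
    simp only [id]
    linarith
  have hbot : Tendsto P atBot atBot := by
    refine tendsto_atBot_mono' _ ?_ (tendsto_id.const_mul_atBot ha)
    filter_upwards [eventually_le_atBot 0] with x hx
    have := hsub hx
    simp only [h0, mul_zero, sub_zero] at this
    simp only [id]
    linarith
  exact ⟨P, h0, hd, hmono, hmono.injective, hcont.surjective htop hbot⟩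

section CantorSystem

variable {d k m : ℕ} {ε : ℝ} {g g' : Fin d → ℝ → ℝ}

theorem wordMap_append_singleton (w : List (Fin d)) (i : Fin d) (x : ℝ) :
    wordMap g (w ++ [i]) x = g i (wordMap g w x) := by
  induction w generalizing x with
  | nil => rfl
  | cons j w ih => exact ih (g j x)

theorem systemCantorSet_subset (hg : IsCantorSystem k ε g) : systemCantorSet g ⊆ I01 := by
  intro x hx
  have h0 := mem_iInter.mp hx 0
  simp only [mem_iUnion, mem_ofPred_eq, exists_prop] at h0
  obtain ⟨w, hw, y, hy, rfl⟩ := h0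
  obtain ⟨i, rfl⟩ := List.length_eq_one_iff.mp hw
  exact hg.maps i hy

theorem map_mem_systemCantorSet (hg : IsCantorSystem k ε g) (i : Fin d) {x : ℝ}
    (hx : x ∈ systemCantorSet g) : g i x ∈ systemCantorSet g := by
  have hxI := systemCantorSet_subset hg hx
  refine mem_iInter.mpr fun n => ?_
  simp only [mem_iUnion, mem_ofPred_eq, exists_prop]
  cases n with
  | zero => exact ⟨[i], rfl, x, hxI, rfl⟩
  | succ n =>
    have h := mem_iInter.mp hx n
    simp only [mem_iUnion, mem_ofPred_eq, exists_prop] at h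
    obtain ⟨w, hw, y, hy, rfl⟩ := h
    exact ⟨w ++ [i], by simp [hw], y, hy, wordMap_append_singleton w i y⟩

theorem mem_systemCantorSet_of_fixed {i : Fin d} {x : ℝ} (hx : x ∈ I01) (h : g i x = x) :
    x ∈ systemCantorSet g := by
  refine mem_iInter.mpr fun n => ?_
  simp only [mem_iUnion, mem_ofPred_eq, exists_prop]
  refine ⟨List.replicate (n + 1) i, List.length_replicate, x, hx, ?_⟩
  generalize n + 1 = l
  induction l with
  | zero => rfl
  | succ l ih => exact (congrArg _ h).trans ih

/-- The branch fixing `0` is linearized by a diffeomorphism `h` with `log h'` of Hölder class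
one order below the system. -/
theorem exists_linearizer (hε : 0 < ε) (hε1 : ε ≤ 1) (hg : IsCantorSystem (m + 1) ε g)
    {i : Fin d} (hi : (i : ℕ) = 0) :
    ∃ (u h : ℝ → ℝ) (l : ℝ), 0 < l ∧ HolderClass ε I01 m u ∧ Continuous u ∧ u 0 = 0 ∧
      h 0 = 0 ∧ (∀ x, HasDerivAt h (Real.exp (u x)) x) ∧ StrictMono h ∧
      Function.Bijective h ∧ (∀ x ∈ I01, h (g i x) = l * h x) ∧
      ∀ x ∈ I01, Tendsto (fun n => (g i)^[n] x) atTop (nhdsWithin 0 I01) := by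
  have hI : Convex ℝ I01 := convex_Icc 0 1
  have h0 : (0 : ℝ) ∈ I01 := ⟨le_rfl, zero_le_one⟩
  have hf0 : g i 0 = 0 := hg.first i hi
  have hsm := hg.smooth i
  obtain ⟨H, -, hH⟩ := hg.holder i
  have hD := (contDiffOn_succ_iff_derivWithin (n := (m : WithTop ℕ∞))
    (uniqueDiffOn_Icc (zero_lt_one' ℝ))).mp (by exact_mod_cast hsm)
  have hf : ∀ x ∈ I01, HasDerivWithinAt (g i) (derivWithin (g i) I01 x) I01 x := fun x hx =>
    (hD.1 x hx).hasDerivWithinAt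
  have hf' : HolderClass ε I01 m (derivWithin (g i) I01) :=
    HolderClass.of_contDiffOn zero_lt_one hD.2.2
      (by simpa only [HolderBoundOn01, iteratedDerivWithin_succ'] using hH)
  have hcont := hf'.continuousOn hε hε1 hI
  obtain ⟨a, haI, ha⟩ := isCompact_Icc.exists_isMinOn ⟨0, h0⟩ hcont
  obtain ⟨b, hbI, hb⟩ := isCompact_Icc.exists_isMaxOn ⟨0, h0⟩ hcont
  have hθ := (hg.deriv_pos i b hbI).le
  have hθ1 := hg.deriv_lt_one i b hbI
  have hL : ∀ x ∈ I01, ∀ y ∈ I01, |g i x - g i y| ≤ derivWithin (g i) I01 b * |x - y| :=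
    fun x hx y hy => abs_sub_le_of_hasDerivWithinAt hI hf
      (fun t ht => by rw [abs_of_pos (hg.deriv_pos i t ht)]; exact hb ht) hx hy
  obtain ⟨u, hu, hu0, hfu⟩ := exists_log_linearizer hε hε1 (hg.maps i) hf0 hθ hθ1 hL hf
    (hg.deriv_pos i a haI) (fun x hx => ha hx) (hg.deriv_lt_one i 0 h0) hf'
  obtain ⟨B, -, hB⟩ := hu.bounded
  have huc : Continuous (IccExtend zero_le_one (I01.domRestrict u)) :=
    (continuousOn_iff_continuous_domRestrict.mp (hu.continuousOn hε hε1 hI)).Icc_extend'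
  have hue : ∀ x ∈ I01, IccExtend zero_le_one (I01.domRestrict u) x = u x := fun x hx =>
    IccExtend_of_mem _ _ hx
  obtain ⟨h, hh0, hh, hmono, hbij⟩ := exists_increasing_primitive (Real.continuous_exp.comp huc)
    (Real.exp_pos (-B)) fun x => Real.exp_le_exp.mpr
      (abs_le.mp (hB _ (projIcc (0 : ℝ) 1 zero_le_one x).2)).1
  refine ⟨_, h, derivWithin (g i) I01 0, hg.deriv_pos i 0 h0, hu.congr hue, huc,
    (hue 0 h0).trans hu0, hh0, hh, hmono, hbij, fun x hx => ?_,
    fun x hx => tendsto_iterate_zero (hg.maps i) hf0 hθ hθ1 hL hx⟩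
  refine eq_of_hasDerivWithinAt_eq hI (v := fun x => h (g i x))
    (w := fun x => derivWithin (g i) I01 0 * h x)
    (q := fun x => derivWithin (g i) I01 0 * Real.exp (u x)) (fun y hy => ?_) (fun y hy => ?_) h0
    (by simp [hf0, hh0]) hx
  · refine ((hh (g i y)).comp_hasDerivWithinAt y (hf y hy)).congr_deriv ?_
    rw [Function.comp_apply, hue _ (hg.maps i hy), ← hfu y hy, mul_comm]
  · have := (hh y).hasDerivWithinAt (s := I01).const_mul (derivWithin (g i) I01 0)
    rwa [Function.comp_apply, hue y hy] at this

theorem linearizer_conjugacy {f₁ f₂ h₁ h₂ Φ : ℝ → ℝ} {C : Set ℝ} {l₁ l₂ c : ℝ}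
    (hl₁ : 0 < l₁) (hh₁ : h₁ 0 = 0) (hh₂ : h₂ 0 = 0) (hΦ0 : Φ 0 = 0)
    (hd₁ : HasDerivAt h₁ 1 0) (hd₂ : HasDerivAt h₂ 1 0) (hΦ : HasDerivAt Φ c 0) (hc : c ≠ 0)
    (hinj : Function.Injective h₁)
    (hf₁ : ∀ x ∈ C, h₁ (f₁ x) = l₁ * h₁ x) (hf₂ : ∀ x ∈ C, h₂ (f₂ (Φ x)) = l₂ * h₂ (Φ x))
    (hC : ∀ x ∈ C, f₁ x ∈ C) (hconj : ∀ x ∈ C, Φ (f₁ x) = f₂ (Φ x))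
    (hlim : ∀ x ∈ C, Tendsto (fun n => f₁^[n] x) atTop (nhds 0)) :
    ∀ x ∈ C, h₂ (Φ x) = c * h₁ x := by
  intro x hx
  rcases eq_or_ne x 0 with rfl | hx0
  · simp [hΦ0, hh₁, hh₂]
  have hne : h₁ x ≠ 0 := fun h => hx0 (hinj (h.trans hh₁.symm))
  have hmem : ∀ n : ℕ, f₁^[n] x ∈ C := fun n => by
    induction n with
    | zero => exact hx
    | succ n ih => rw [Function.iterate_succ_apply']; exact hC _ ih
  have h1 : ∀ n : ℕ, h₁ (f₁^[n] x) = l₁ ^ n * h₁ x := fun n => by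
    induction n with
    | zero => simp
    | succ n ih => rw [Function.iterate_succ_apply', hf₁ _ (hmem n), ih, pow_succ]; ring
  have h2 : ∀ n : ℕ, h₂ (Φ (f₁^[n] x)) = l₂ ^ n * h₂ (Φ x) := fun n => by
    induction n with
    | zero => simp
    | succ n ih =>
      rw [Function.iterate_succ_apply', hconj _ (hmem n), hf₂ _ (hmem n), ih, pow_succ]; ring
  have hseq : Tendsto (fun n => f₁^[n] x) atTop (nhdsWithin 0 {0}ᶜ) := by
    refine tendsto_nhdsWithin_iff.mpr ⟨hlim x hx, Eventually.of_forall fun n h => ?_⟩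
    have h3 := h1 n
    rw [mem_singleton_iff.mp h, hh₁] at h3
    exact mul_ne_zero (pow_pos hl₁ n).ne' hne h3.symm
  have hd : HasDerivAt (h₂ ∘ Φ) (1 * c) 0 := HasDerivAt.comp 0 (by rwa [hΦ0]) hΦ
  have hratio := ((hasDerivAt_iff_tendsto_slope_zero.mp hd).div
    (hasDerivAt_iff_tendsto_slope_zero.mp hd₁) one_ne_zero).comp hseq
  have hr : Tendsto (fun n : ℕ => (l₂ / l₁) ^ n * (h₂ (Φ x) / h₁ x)) atTop (nhds c) := by
    rw [one_mul, div_one] at hratio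
    refine hratio.congr' ?_
    filter_upwards [(tendsto_nhdsWithin_iff.mp hseq).2] with n hn
    have hn' : f₁^[n] x ≠ 0 := hn
    simp only [Function.comp_apply, Pi.div_apply, zero_add, hΦ0, hh₁, hh₂, sub_zero, smul_eq_mul,
      h1, h2]
    have := (pow_pos hl₁ n).ne'
    rw [div_pow]
    field_simp
  have hq : l₂ / l₁ = 1 := by
    have h3 := hr.const_mul (l₂ / l₁)
    have h4 := hr.comp (tendsto_add_atTop_nat 1)
    have h5 : ((fun n : ℕ => (l₂ / l₁) ^ n * (h₂ (Φ x) / h₁ x)) ∘ fun n => n + 1) =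
        fun n => l₂ / l₁ * ((l₂ / l₁) ^ n * (h₂ (Φ x) / h₁ x)) := by
      funext n
      simp only [Function.comp_apply, pow_succ]
      ring
    rw [h5] at h4
    exact mul_right_cancel₀ hc ((tendsto_nhds_unique h3 h4).trans (one_mul c).symm)
  simp only [hq, one_pow, one_mul] at hr
  have := tendsto_nhds_unique hr tendsto_const_nhds
  rw [this, div_mul_cancel₀ _ hne]

end CantorSystem

/-- A smooth bounded map of the line which is the identity on `[0,1]`. -/
theorem exists_bounded_retraction {ε : ℝ} (hε : 0 < ε) (hε1 : ε ≤ 1) (m : ℕ) :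
    ∃ (χ : ℝ → ℝ) (R L : ℝ), 1 ≤ R ∧ HolderClass ε univ m χ ∧ (∀ x, χ x ∈ Icc (-R) R) ∧
      (∀ x y, |χ x - χ y| ≤ L * |x - y|) ∧ ∀ x ∈ I01, χ x = x := by
  let η : ContDiffBump (1 / 2 : ℝ) := ⟨1, 2, one_pos, one_lt_two⟩
  have hsm : ContDiff ℝ (⊤ : ℕ∞) fun x => x * η x := contDiff_id.mul η.contDiff
  have hs : HasCompactSupport fun x => x * η x := η.hasCompactSupport.mul_left
  have hd := contDiff_infty_iff_deriv.mp hsm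
  obtain ⟨R, hR⟩ := hs.exists_bound_of_continuous hsm.continuous
  obtain ⟨L, hL⟩ := hs.deriv.exists_bound_of_continuous hd.2.continuous
  refine ⟨fun x => x * η x, max R 1, L, le_max_right _ _,
    HolderClass.of_hasCompactSupport hε hε1 hsm hs,
    fun x => abs_le.mp ((hR x).trans (le_max_left _ _)), fun x y =>
      abs_sub_le_of_hasDerivWithinAt convex_univ (fun t _ => (hd.1 t).hasDerivAt.hasDerivWithinAt)
        (fun t _ => hL t) trivial trivial, fun x hx => ?_⟩
  have : η x = 1 := η.one_of_mem_closedBall (by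
    rw [Metric.mem_closedBall, Real.dist_eq, abs_le]
    constructor <;> simp only [η] <;> linarith [hx.1, hx.2])
  simp only [this, mul_one]

/-- A function with derivative `exp s` on `[0,1]` extends to a diffeomorphism of the line. -/
theorem exists_diffeo_extension {ε : ℝ} (hε : 0 < ε) (hε1 : ε ≤ 1) {m : ℕ} {s ψ : ℝ → ℝ}
    (hs : HolderClass ε I01 m s) (hψ0 : ψ 0 = 0)
    (hψ : ∀ x ∈ I01, HasDerivWithinAt ψ (Real.exp (s x)) I01 x) :
    ∃ Ψ : ℝ → ℝ, ContDiff ℝ (m + 1 : ℕ) Ψ ∧ StrictMono Ψ ∧ Function.Bijective Ψ ∧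
      (∀ x, 0 < deriv Ψ x) ∧
      (∃ H > 0, ∀ x y : ℝ,
        |iteratedDeriv (m + 1) Ψ x - iteratedDeriv (m + 1) Ψ y| ≤ H * |x - y| ^ ε) ∧
      ∀ x ∈ I01, Ψ x = ψ x := by
  obtain ⟨χ, R, L, hR, hχ, hχR, hχL, hχI⟩ := exists_bounded_retraction hε hε1 m
  obtain ⟨w, hw, hws⟩ := hs.exists_extension hε hε1 zero_le_one (A := -R) (B := R)
    (by linarith) hR
  have hS := hw.comp hε hε1 convex_univ (fun x _ y _ => hχL x y) (fun x _ => hχR x) hχ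
  obtain ⟨B, -, hB⟩ := hS.bounded
  have hE := hS.exp hε hε1 convex_univ
  have hEc := continuousOn_univ.mp (hE.continuousOn hε hε1 convex_univ)
  obtain ⟨Ψ, hΨ0, hΨ, hmono, hbij⟩ := exists_increasing_primitive hEc (Real.exp_pos (-B))
    fun x => Real.exp_le_exp.mpr (abs_le.mp (hB x trivial)).1
  have hderiv : deriv Ψ = fun x => Real.exp (w (χ x)) := funext fun x => (hΨ x).deriv
  obtain ⟨hE1, hE2⟩ := hE.contDiff hε hε1
  refine ⟨Ψ, ?_, hmono, hbij, fun x => ?_, by simpa only [iteratedDeriv_succ', hderiv] using hE2,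
    fun x hx => ?_⟩
  · push_cast
    rw [contDiff_succ_iff_deriv]
    exact ⟨fun x => (hΨ x).differentiableAt, by simp, by rwa [hderiv]⟩
  · rw [hderiv]; exact Real.exp_pos _
  · refine eq_of_hasDerivWithinAt_eq (convex_Icc 0 1) (fun y hy => (hΨ y).hasDerivWithinAt)
      (fun y hy => ?_) ⟨le_rfl, zero_le_one⟩ (hΨ0.trans hψ0.symm) hx
    rw [hχI y hy, hws y hy]
    exact hψ y hy

/-- Corollary, rigidity of `C^1` conjugacies: if an increasing `C^1`
diffeomorphism `Φ` of `ℝ` maps the Cantor set of one `C^{k+ε}` system onto that of another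
and conjugates the systems on the Cantor set, then `Φ` agrees on the Cantor set with an
increasing `C^k` diffeomorphism of `ℝ` whose `k`-th derivative is `ε`-Hölder continuous. -/
theorem stmt16 (d k : ℕ) (hd : 2 ≤ d) (hk : 1 ≤ k) (hkd : k < 2*d)
    (ε : ℝ) (hε : ε ∈ Set.Ioc (0:ℝ) 1)
    (g g' : Fin d → ℝ → ℝ) (hg : IsCantorSystem k ε g) (hg' : IsCantorSystem k ε g')
    (Φ : ℝ → ℝ) (hΦsm : ContDiff ℝ 1 Φ) (hΦmono : StrictMono Φ)
    (hΦbij : Function.Bijective Φ) (hΦderiv : ∀ x, 0 < deriv Φ x)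
    (hΦC : Φ '' systemCantorSet g = systemCantorSet g')
    (hconj : ∀ i : Fin d, ∀ x ∈ systemCantorSet g, Φ (g i x) = g' i (Φ x)) :
    ∃ Ψ : ℝ → ℝ, ContDiff ℝ k Ψ ∧ StrictMono Ψ ∧ Function.Bijective Ψ ∧
      (∀ x, 0 < deriv Ψ x) ∧
      (∃ H > 0, ∀ x y : ℝ, |iteratedDeriv k Ψ x - iteratedDeriv k Ψ y| ≤ H * |x - y| ^ ε) ∧
      ∀ x ∈ systemCantorSet g, Ψ x = Φ x := by
  obtain ⟨m, rfl⟩ : ∃ m, k = m + 1 := ⟨k - 1, by omega⟩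
  obtain ⟨hε0, hε1⟩ := hε
  have hI : Convex ℝ I01 := convex_Icc 0 1
  have h0 : (0 : ℝ) ∈ I01 := ⟨le_rfl, zero_le_one⟩
  have h1 : (1 : ℝ) ∈ I01 := ⟨zero_le_one, le_rfl⟩
  let i₀ : Fin d := ⟨0, by omega⟩
  let i₁ : Fin d := ⟨d - 1, by omega⟩
  have hCI := systemCantorSet_subset hg
  have hCI' := systemCantorSet_subset hg'
  have hΦmem : ∀ x ∈ systemCantorSet g, Φ x ∈ systemCantorSet g' := fun x hx =>
    hΦC ▸ mem_image_of_mem Φ hx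
  have h0C : (0 : ℝ) ∈ systemCantorSet g := mem_systemCantorSet_of_fixed h0 (hg.first i₀ rfl)
  have h1C : (1 : ℝ) ∈ systemCantorSet g := mem_systemCantorSet_of_fixed h1 (hg.last i₁ rfl)
  have hΦ0 : Φ 0 = 0 := by
    have h : (0 : ℝ) ∈ Φ '' systemCantorSet g :=
      hΦC ▸ mem_systemCantorSet_of_fixed h0 (hg'.first i₀ rfl)
    obtain ⟨x, hx, hx0⟩ := h
    exact le_antisymm ((hΦmono.monotone (hCI hx).1).trans_eq hx0) (hCI' (hΦmem 0 h0C)).1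
  have hΦ1 : Φ 1 = 1 := by
    have h : (1 : ℝ) ∈ Φ '' systemCantorSet g :=
      hΦC ▸ mem_systemCantorSet_of_fixed h1 (hg'.last i₁ rfl)
    obtain ⟨x, hx, hx1⟩ := h
    exact le_antisymm (hCI' (hΦmem 1 h1C)).2 (hx1.symm.trans_le (hΦmono.monotone (hCI hx).2))
  obtain ⟨u₁, h₁, l₁, hl₁, hu₁, hu₁c, hu₁0, hh₁0, hh₁, hmono₁, hbij₁, heq₁, hlim₁⟩ :=
    exists_linearizer hε0 hε1 hg (i := i₀) rfl
  obtain ⟨u₂, h₂, l₂, hl₂, hu₂, hu₂c, hu₂0, hh₂0, hh₂, hmono₂, hbij₂, heq₂, -⟩ :=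
    exists_linearizer hε0 hε1 hg' (i := i₀) rfl
  have hc := hΦderiv 0
  have key : ∀ x ∈ systemCantorSet g, h₂ (Φ x) = deriv Φ 0 * h₁ x :=
    linearizer_conjugacy hl₁ hh₁0 hh₂0 hΦ0 (by simpa [hu₁0] using hh₁ 0)
      (by simpa [hu₂0] using hh₂ 0) (hΦsm.differentiable one_ne_zero 0).hasDerivAt hc.ne'
      hbij₁.injective (fun x hx => heq₁ x (hCI hx)) (fun x hx => heq₂ _ (hCI' (hΦmem x hx)))
      (fun x hx => map_mem_systemCantorSet hg i₀ hx) (hconj i₀)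
      fun x hx => (tendsto_nhdsWithin_iff.mp (hlim₁ x (hCI hx))).1
  let e := hmono₂.orderIsoOfSurjective h₂ hbij₂.surjective
  let ψ : ℝ → ℝ := fun x => e.symm (deriv Φ 0 * h₁ x)
  have hψ : ∀ x, h₂ (ψ x) = deriv Φ 0 * h₁ x := fun x => e.apply_symm_apply _
  have hψC : ∀ x ∈ systemCantorSet g, ψ x = Φ x := fun x hx =>
    hbij₂.injective ((hψ x).trans (key x hx).symm)
  have hψmono : Monotone ψ := fun x y hxy =>
    e.symm.monotone (mul_le_mul_of_nonneg_left (hmono₁.monotone hxy) hc.le)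
  have hψ0 : ψ 0 = 0 := (hψC 0 h0C).trans hΦ0
  have hψ1 : ψ 1 = 1 := (hψC 1 h1C).trans hΦ1
  have hψmaps : MapsTo ψ I01 I01 := fun x hx =>
    ⟨hψ0.symm.trans_le (hψmono hx.1), (hψmono hx.2).trans_eq hψ1⟩
  let s : ℝ → ℝ := fun x => Real.log (deriv Φ 0) + u₁ x + -1 * u₂ (ψ x)
  have hψd : ∀ x, HasDerivAt ψ (Real.exp (s x)) x := by
    intro x
    have hinv : HasDerivAt e.symm (Real.exp (u₂ (ψ x)))⁻¹ (deriv Φ 0 * h₁ x) :=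
      HasDerivAt.of_local_left_inverse e.symm.continuous.continuousAt (hh₂ (ψ x))
        (Real.exp_ne_zero _) (Eventually.of_forall fun y => e.apply_symm_apply y)
    refine (hinv.comp x ((hh₁ x).const_mul (deriv Φ 0))).congr_deriv ?_
    simp only [s, Real.exp_add, Real.exp_log hc, neg_one_mul, Real.exp_neg]
    ring
  have hψc : Continuous ψ := continuous_iff_continuousAt.mpr fun x => (hψd x).continuousAt
  have hsc : Continuous s := by fun_prop
  obtain ⟨L, hL⟩ := isCompact_Icc.exists_bound_of_continuousOn
    (Real.continuous_exp.comp hsc).continuousOn (s := I01)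
  have hψL : ∀ x ∈ I01, ∀ y ∈ I01, |ψ x - ψ y| ≤ L * |x - y| := fun x hx y hy =>
    abs_sub_le_of_hasDerivWithinAt hI (fun t _ => (hψd t).hasDerivWithinAt) hL hx hy
  have hψB : ∀ x ∈ I01, |ψ x| ≤ 1 := fun x hx =>
    abs_le.mpr ⟨by linarith [(hψmaps hx).1], (hψmaps hx).2⟩
  have hs : ∀ n ≤ m, HolderClass ε I01 n ψ → HolderClass ε I01 n s := fun n hn hψn =>
    ((HolderClass.const _).add (hu₁.of_le hε0 hε1 hI hn)).add
      ((HolderClass.const (-1)).mul hε0 hε1 hI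
        ((hu₂.of_le hε0 hε1 hI hn).comp hε0 hε1 hI hψL hψmaps hψn))
  have hψH : ∀ n ≤ m, HolderClass ε I01 n ψ := by
    intro n
    induction n with
    | zero => exact fun _ => HolderClass.of_lipschitz hε0 hε1 hψB hψL
    | succ n ih =>
      intro hn
      exact ⟨⟨1, hψB⟩, _, fun x _ => (hψd x).hasDerivWithinAt,
        (hs n (by omega) (ih (by omega))).exp hε0 hε1 hI⟩
  obtain ⟨Ψ, h_smooth, h_mono, h_bij, h_pos, h_holder, h_eq⟩ :=
    exists_diffeo_extension hε0 hε1 (hs m le_rfl (hψH m le_rfl)) hψ0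
      fun x _ => (hψd x).hasDerivWithinAt
  exact ⟨Ψ, h_smooth, h_mono, h_bij, h_pos, h_holder,
    fun x hx => (h_eq x (hCI hx)).trans (hψC x hx)⟩
end

section
/- For every integer d ≥ 2 and all 0 < ε₁ < ε₂ ≤ 1 there exists a function S : Σ_d^dual → Simp_{2d−2} such that S is the scaling function of some C^{1+ε₁} Cantor system on [0,1] with d branches, but S is not the scaling function of any C^{1+ε₂} Cantor system on [0,1] with d branches. -/
open Set Filter

section CantorSystem

variable {d : ℕ} {ε : ℝ} {g : Fin d → ℝ → ℝ}

/-- Uniform control of the branch derivatives of a `C^{1+ε}` Cantor system. -/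
theorem IsCantorSystem.exists_derivWithin_bounds (hg : IsCantorSystem 1 ε g) :
    ∃ m > 0, ∃ κ ∈ Ioo (0:ℝ) 1, ∃ H > 0, ∀ i, ∀ x ∈ I01,
      m ≤ derivWithin (g i) I01 x ∧ derivWithin (g i) I01 x ≤ κ ∧
      ∀ y ∈ I01, |derivWithin (g i) I01 x - derivWithin (g i) I01 y| ≤ H * |x - y| ^ ε := by
  have hne : (I01).Nonempty := ⟨0, by simp⟩
  have hcont (i : Fin d) : ContinuousOn (derivWithin (g i) I01) I01 :=
    (hg.smooth i).continuousOn_derivWithin (uniqueDiffOn_Icc zero_lt_one) (by simp)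
  have hmin (i : Fin d) : ∃ m : Ioi (0:ℝ), ∀ x ∈ I01, (m:ℝ) ≤ derivWithin (g i) I01 x := by
    obtain ⟨a, ha, h⟩ := isCompact_Icc.exists_isMinOn hne (hcont i)
    exact ⟨⟨_, hg.deriv_pos i a ha⟩, fun x hx => h hx⟩
  have hmax (i : Fin d) : ∃ κ : Ioo (0:ℝ) 1, ∀ x ∈ I01, derivWithin (g i) I01 x ≤ κ := by
    obtain ⟨a, ha, h⟩ := isCompact_Icc.exists_isMaxOn hne (hcont i)
    exact ⟨⟨_, hg.deriv_pos i a ha, hg.deriv_lt_one i a ha⟩, fun x hx => h hx⟩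
  choose m hm using hmin
  choose κ hκ using hmax
  choose H hH0 hH using hg.holder
  simp only [iteratedDerivWithin_one] at hH
  have : Nonempty (Ioi (0:ℝ)) := ⟨⟨1, by simp⟩⟩
  have : Nonempty (Ioo (0:ℝ) 1) := ⟨⟨1 / 2, by norm_num⟩⟩
  obtain ⟨m', hm'⟩ := Finite.exists_ge m
  obtain ⟨κ', hκ'⟩ := Finite.exists_le κ
  obtain ⟨H', hH'⟩ := Finite.exists_le (fun i => (⟨H i, hH0 i⟩ : Ioi (0:ℝ)))
  refine ⟨m', m'.2, κ', κ'.2, H', H'.2, fun i x hx => ⟨?_, ?_, fun y hy => ?_⟩⟩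
  · exact le_trans (hm' i) (hm i x hx)
  · exact le_trans (hκ i x hx) (hκ' i)
  · exact (hH i x hx y hy).trans (mul_le_mul_of_nonneg_right (hH' i) (by positivity))

/-- The mean value theorem for a branch of a Cantor system. -/
theorem IsCantorSystem.exists_derivWithin_eq (hg : IsCantorSystem 1 ε g) (i : Fin d) {a b : ℝ}
    (ha : a ∈ I01) (hb : b ∈ I01) (hab : a ≤ b) :
    ∃ ξ ∈ Icc a b, g i b - g i a = derivWithin (g i) I01 ξ * (b - a) := by
  rcases hab.eq_or_lt with rfl | hlt
  · exact ⟨a, by simp, by simp⟩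
  have hsub : Icc a b ⊆ I01 := Icc_subset_Icc ha.1 hb.2
  obtain ⟨ξ, hξ, h⟩ := exists_deriv_eq_slope (g i) hlt ((hg.smooth i).continuousOn.mono hsub)
    (((hg.smooth i).differentiableOn (by simp)).mono (Ioo_subset_Icc_self.trans hsub))
  refine ⟨ξ, Ioo_subset_Icc_self hξ, ?_⟩
  rw [derivWithin_of_mem_nhds (Icc_mem_nhds (ha.1.trans_lt hξ.1) (hξ.2.trans_le hb.2)), h,
    div_mul_cancel₀ _ (sub_pos.2 hlt).ne']

theorem IsCantorSystem.strictMonoOn (hg : IsCantorSystem 1 ε g) (i : Fin d) :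
    StrictMonoOn (g i) I01 := by
  intro a ha b hb hab
  obtain ⟨ξ, hξ, h⟩ := hg.exists_derivWithin_eq i ha hb hab.le
  have := mul_pos (hg.deriv_pos i ξ (Icc_subset_Icc ha.1 hb.2 hξ)) (sub_pos.2 hab)
  linarith

theorem IsCantorSystem.mapsTo_wordMap (hg : IsCantorSystem 1 ε g) (w : List (Fin d)) :
    MapsTo (wordMap g w) I01 I01 := by
  induction w with
  | nil => exact mapsTo_id _
  | cons i w ih => exact ih.comp (hg.maps i)

theorem IsCantorSystem.strictMonoOn_wordMap (hg : IsCantorSystem 1 ε g) (w : List (Fin d)) :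
    StrictMonoOn (wordMap g w) I01 := by
  induction w with
  | nil => exact strictMonoOn_id
  | cons i w ih => exact ih.comp (hg.strictMonoOn i) (hg.maps i)

theorem IsCantorSystem.wordLen_pos (hg : IsCantorSystem 1 ε g) (w : List (Fin d)) :
    0 < wordLen g w :=
  sub_pos.2 (hg.strictMonoOn_wordMap w (by simp) (by simp) zero_lt_one)

theorem wordMap_append (g : Fin d → ℝ → ℝ) (v w : List (Fin d)) (x : ℝ) :
    wordMap g (v ++ w) x = wordMap g w (wordMap g v x) := by
  induction v generalizing x with
  | nil => rfl
  | cons i v ih => exact ih (g i x)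

/-- Bounded distortion: a word map changes ratios of lengths of nested intervals by at most a
constant times the `ε`-th power of the length of the larger interval. -/
theorem IsCantorSystem.exists_distortion (hg : IsCantorSystem 1 ε g) (hε : 0 < ε) :
    ∃ C > 0, ∀ (w : List (Fin d)) (p a c q : ℝ), p ∈ I01 → q ∈ I01 → p ≤ a → a ≤ c → c ≤ q →
      p < q → |(wordMap g w c - wordMap g w a) / (wordMap g w q - wordMap g w p)
        - (c - a) / (q - p)| ≤ C * (q - p) ^ ε := by
  obtain ⟨m, hm, κ, hκ, H, hH, hb⟩ := hg.exists_derivWithin_bounds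
  have hκ1 : κ ^ ε < 1 := Real.rpow_lt_one hκ.1.le hκ.2 hε
  have h1κ : 0 < 1 - κ ^ ε := sub_pos.2 hκ1
  refine ⟨H / m / (1 - κ ^ ε), by positivity, fun w => ?_⟩
  induction w with
  | nil =>
    intro p a c q _ _ _ _ _ hpq
    simp only [wordMap, id, sub_self, abs_zero]
    have := sub_pos.2 hpq
    positivity
  | cons i w ih =>
    intro p a c q hp hq hpa hac hcq hpq
    have ha : a ∈ I01 := ⟨hp.1.trans hpa, (hac.trans hcq).trans hq.2⟩
    have hc : c ∈ I01 := ⟨ha.1.trans hac, hcq.trans hq.2⟩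
    have hpq' := sub_pos.2 hpq
    have hmono := hg.strictMonoOn i
    have hstep := ih (g i p) (g i a) (g i c) (g i q) (hg.maps i hp) (hg.maps i hq)
      (hmono.monotoneOn hp ha hpa) (hmono.monotoneOn ha hc hac) (hmono.monotoneOn hc hq hcq)
      (hmono hp hq hpq)
    obtain ⟨ξ, hξ, hξe⟩ := hg.exists_derivWithin_eq i ha hc hac
    obtain ⟨η, hη, hηe⟩ := hg.exists_derivWithin_eq i hp hq hpq.le
    have hξI : ξ ∈ I01 := Icc_subset_Icc ha.1 hc.2 hξ
    have hηI : η ∈ I01 := Icc_subset_Icc hp.1 hq.2 hη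
    obtain ⟨hηm, hηκ, -⟩ := hb i η hηI
    have hD : |derivWithin (g i) I01 ξ - derivWithin (g i) I01 η| ≤ H * (q - p) ^ ε := by
      refine ((hb i ξ hξI).2.2 η hηI).trans ?_
      gcongr
      rw [abs_le]
      constructor <;> linarith [hξ.1, hξ.2, hη.1, hη.2]
    have hηpos : 0 < derivWithin (g i) I01 η := hm.trans_le hηm
    have hone : |(g i c - g i a) / (g i q - g i p) - (c - a) / (q - p)|
        ≤ H / m * (q - p) ^ ε := by
      have e : (g i c - g i a) / (g i q - g i p) - (c - a) / (q - p)
          = (c - a) / (q - p) * ((derivWithin (g i) I01 ξ - derivWithin (g i) I01 η)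
            / derivWithin (g i) I01 η) := by
        rw [hξe, hηe]; field_simp
      rw [e, abs_mul, abs_div, abs_div, abs_of_pos hpq', abs_of_pos hηpos,
        abs_of_nonneg (sub_nonneg.2 hac)]
      have h1 : (c - a) / (q - p) ≤ 1 := (div_le_one hpq').2 (by linarith)
      have h2 : |derivWithin (g i) I01 ξ - derivWithin (g i) I01 η| / derivWithin (g i) I01 η
          ≤ H * (q - p) ^ ε / m := by gcongr
      calc _ ≤ 1 * (H * (q - p) ^ ε / m) := by gcongr
        _ = _ := by ring
    have hlen : (g i q - g i p) ^ ε ≤ κ ^ ε * (q - p) ^ ε := by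
      rw [← Real.mul_rpow hκ.1.le hpq'.le, hηe]
      gcongr
    calc _ ≤ _ := abs_sub_le _ ((g i c - g i a) / (g i q - g i p)) _
      _ ≤ H / m / (1 - κ ^ ε) * (κ ^ ε * (q - p) ^ ε) + H / m * (q - p) ^ ε :=
        add_le_add (hstep.trans (by gcongr)) hone
      _ = _ := by field_simp; ring

theorem IsCantorSystem.exists_wordLen_le (hg : IsCantorSystem 1 ε g) :
    ∃ κ ∈ Ioo (0:ℝ) 1, ∀ w : List (Fin d), wordLen g w ≤ κ ^ w.length := by
  obtain ⟨m, hm, κ, hκ, H, hH, hb⟩ := hg.exists_derivWithin_bounds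
  have key : ∀ w : List (Fin d), ∀ a ∈ I01, ∀ b ∈ I01, a ≤ b →
      wordMap g w b - wordMap g w a ≤ κ ^ w.length * (b - a) := by
    intro w
    induction w with
    | nil => intro a _ b _ _; simp [wordMap]
    | cons i w ih =>
      intro a ha b hb' hab
      obtain ⟨ξ, hξ, hξe⟩ := hg.exists_derivWithin_eq i ha hb' hab
      have hκξ := (hb i ξ (Icc_subset_Icc ha.1 hb'.2 hξ)).2.1
      have hκ0 := hκ.1
      refine (ih _ (hg.maps i ha) _ (hg.maps i hb')
        ((hg.strictMonoOn i).monotoneOn ha hb' hab)).trans ?_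
      rw [hξe, List.length_cons, pow_succ, mul_assoc]
      have := sub_nonneg.2 hab
      gcongr
  exact ⟨κ, hκ, fun w => by simpa [wordLen] using key w 0 (by simp) 1 (by simp) zero_le_one⟩

/-- Each coordinate of the scaling data is a ratio of lengths of nested intervals. -/
theorem IsCantorSystem.exists_scalingData_eq (hg : IsCantorSystem 1 ε g) (m : Fin (2*d-1)) :
    ∃ a c : ℝ, 0 ≤ a ∧ a ≤ c ∧ c ≤ 1 ∧ ∀ w, scalingData g w m =
      (wordMap g w c - wordMap g w a) / (wordMap g w 1 - wordMap g w 0) := by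
  have h0 : (0:ℝ) ∈ I01 := by simp
  have h1 : (1:ℝ) ∈ I01 := by simp
  by_cases h : (m : ℕ) < d
  · refine ⟨g ⟨m, h⟩ 0, g ⟨m, h⟩ 1, (hg.maps _ h0).1,
      ((hg.strictMonoOn _) h0 h1 zero_lt_one).le, (hg.maps _ h1).2, fun w => ?_⟩
    simp only [scalingData, h, dif_pos]
    rfl
  · have hm := m.isLt
    refine ⟨g ⟨(m : ℕ) - d, by omega⟩ 1, g ⟨(m : ℕ) - d + 1, by omega⟩ 0, (hg.maps _ h1).1,
      (hg.ordered _ _ ?_).le, (hg.maps _ h0).2, fun w => ?_⟩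
    · simp [Fin.lt_def]
    · simp only [scalingData, h, dif_neg, not_false_eq_true]
      rfl

theorem IsCantorSystem.exists_scalingData_append (hg : IsCantorSystem 1 ε g) (hε : 0 < ε) :
    ∃ C > 0, ∀ (w v : List (Fin d)) (m : Fin (2*d-1)),
      |scalingData g (w ++ v) m - scalingData g w m| ≤ C * wordLen g w ^ ε := by
  obtain ⟨C, hC, h⟩ := hg.exists_distortion hε
  refine ⟨C, hC, fun w v m => ?_⟩
  obtain ⟨a, c, ha, hac, hc, e⟩ := hg.exists_scalingData_eq m
  have h0 : (0:ℝ) ∈ I01 := by simp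
  have h1 : (1:ℝ) ∈ I01 := by simp
  have haI : a ∈ I01 := ⟨ha, hac.trans hc⟩
  have hcI : c ∈ I01 := ⟨ha.trans hac, hc⟩
  have hmono := hg.strictMonoOn_wordMap w
  rw [e, e]
  simp only [wordMap_append]
  exact h v _ _ _ _ (hg.mapsTo_wordMap w h0) (hg.mapsTo_wordMap w h1)
    (hmono.monotoneOn h0 haI ha) (hmono.monotoneOn haI hcI hac)
    (hmono.monotoneOn hcI h1 hc) (hmono h0 h1 zero_lt_one)

theorem dword_add (j : ℕ → Fin d) (n k : ℕ) :
    dword j (n + k) = dword j n ++ dword (fun i => j (n + i)) k := by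
  simp [dword, List.ofFn_add]

theorem dword_const (i : Fin d) (n : ℕ) : dword (fun _ => i) n = List.replicate n i :=
  List.ofFn_const n i

/-- Every `C^{1+ε}` Cantor system has a scaling function. -/
theorem IsCantorSystem.exists_hasScalingFunction (hg : IsCantorSystem 1 ε g) (hε : 0 < ε) :
    ∃ S, HasScalingFunction g S := by
  obtain ⟨C, hC, h⟩ := hg.exists_scalingData_append hε
  obtain ⟨κ, hκ, hlen⟩ := hg.exists_wordLen_le
  have hκ1 : κ ^ ε < 1 := Real.rpow_lt_one hκ.1.le hκ.2 hε
  have key (j : ℕ → Fin d) (m : Fin (2*d-1)) :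
      ∃ s, Tendsto (fun n => scalingData g (dword j n) m) atTop (nhds s) := by
    refine cauchySeq_tendsto_of_complete
      (cauchySeq_of_le_geometric (κ ^ ε) C hκ1 fun n => ?_)
    rw [dist_comm, Real.dist_eq, dword_add]
    refine (h _ _ _).trans ?_
    rw [← Real.rpow_natCast (κ ^ ε), ← Real.rpow_mul hκ.1.le, mul_comm ε, Real.rpow_mul hκ.1.le,
      Real.rpow_natCast]
    have hl := hlen (dword j n)
    have hp := (hg.wordLen_pos (dword j n)).le
    rw [show (dword j n).length = n by simp [dword]] at hl
    gcongr
  choose S hS using key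
  exact ⟨S, fun j => tendsto_pi_nhds.2 (hS j)⟩

/-- Hölder continuity of the scaling function with respect to interval lengths. -/
theorem IsCantorSystem.exists_scalingFunction_sub_le (hg : IsCantorSystem 1 ε g) (hε : 0 < ε)
    {S : (ℕ → Fin d) → Fin (2*d-1) → ℝ} (hS : HasScalingFunction g S) :
    ∃ C > 0, ∀ (j j' : ℕ → Fin d) (n : ℕ) (m : Fin (2*d-1)), dword j n = dword j' n →
      |S j m - S j' m| ≤ C * wordLen g (dword j n) ^ ε := by
  obtain ⟨C, hC, h⟩ := hg.exists_scalingData_append hε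
  have key (j : ℕ → Fin d) (n : ℕ) (m : Fin (2*d-1)) :
      |S j m - scalingData g (dword j n) m| ≤ C * wordLen g (dword j n) ^ ε := by
    have ht := ((tendsto_pi_nhds.1 (hS j) m).sub_const (scalingData g (dword j n) m)).abs
    refine le_of_tendsto ht ((eventually_ge_atTop n).mono fun k hk => ?_)
    obtain ⟨l, rfl⟩ := Nat.exists_eq_add_of_le hk
    rw [dword_add]
    exact h _ _ _
  refine ⟨2 * C, by positivity, fun j j' n m hj => ?_⟩
  have h1 := key j n m
  have h2 := key j' n m
  rw [← hj, abs_sub_comm] at h2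
  linarith [abs_sub_le (S j m) (scalingData g (dword j n) m) (S j' m)]

end CantorSystem

section PowerExample

variable {d : ℕ}

/-- The branches of a Cantor system with `d` branches, all of them affine except the last one,
which has a term `x ^ (1 + ε)`. -/
noncomputable def powerBranch (d : ℕ) (ε : ℝ) (i : Fin d) (x : ℝ) : ℝ :=
  (2 * d - 1 : ℝ)⁻¹ * (2 * (i : ℕ) +
    if (i : ℕ) + 1 = d then (x + x ^ (1 + ε)) / 2 else x)

theorem powerBranch_zero {ε : ℝ} (hε : 0 < ε) (i : Fin d) :
    powerBranch d ε i 0 = (2 * d - 1 : ℝ)⁻¹ * (2 * (i : ℕ)) := by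
  have : (1 + ε) ≠ 0 := by positivity
  simp [powerBranch, Real.zero_rpow this]

theorem powerBranch_one {ε : ℝ} (i : Fin d) :
    powerBranch d ε i 1 = (2 * d - 1 : ℝ)⁻¹ * (2 * (i : ℕ) + 1) := by
  simp [powerBranch]

theorem hasDerivAt_powerBranch {ε : ℝ} (hε : 0 < ε) (i : Fin d) (x : ℝ) :
    HasDerivAt (powerBranch d ε i) ((2 * d - 1 : ℝ)⁻¹ *
      if (i : ℕ) + 1 = d then (1 + (1 + ε) * x ^ ε) / 2 else 1) x := by
  unfold powerBranch
  refine HasDerivAt.const_mul _ (HasDerivAt.const_add _ ?_)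
  split_ifs
  · have := Real.hasDerivAt_rpow_const (x := x) (p := 1 + ε) (Or.inr (by linarith))
    rw [add_sub_cancel_left] at this
    exact ((hasDerivAt_id x).add this).div_const 2
  · exact hasDerivAt_id x

theorem derivWithin_powerBranch {ε : ℝ} (hε : 0 < ε) (i : Fin d) {x : ℝ} (hx : x ∈ I01) :
    derivWithin (powerBranch d ε i) I01 x = (2 * d - 1 : ℝ)⁻¹ *
      if (i : ℕ) + 1 = d then (1 + (1 + ε) * x ^ ε) / 2 else 1 :=
  (hasDerivAt_powerBranch hε i x).hasDerivWithinAt.derivWithin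
    (uniqueDiffOn_Icc zero_lt_one x hx)

theorem abs_rpow_sub_rpow_le {ε x y : ℝ} (hε : 0 ≤ ε) (hε1 : ε ≤ 1) (hx : 0 ≤ x) (hy : 0 ≤ y) :
    |x ^ ε - y ^ ε| ≤ |x - y| ^ ε := by
  wlog h : y ≤ x generalizing x y
  · rw [abs_sub_comm, abs_sub_comm x]
    exact this hy hx (le_of_not_ge h)
  rw [abs_of_nonneg (sub_nonneg.2 h),
    abs_of_nonneg (sub_nonneg.2 (Real.rpow_le_rpow hy h hε)), sub_le_iff_le_add]
  simpa using Real.rpow_add_le_add_rpow (sub_nonneg.2 h) hy hε hε1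

theorem isCantorSystem_powerBranch (hd : 2 ≤ d) {ε : ℝ} (hε : 0 < ε) (hε1 : ε ≤ 1) :
    IsCantorSystem 1 ε (powerBranch d ε) := by
  have hd' : (2:ℝ) ≤ d := by exact_mod_cast hd
  have hl : (0:ℝ) < 2 * d - 1 := by linarith
  have hl0 : (0:ℝ) < (2 * d - 1 : ℝ)⁻¹ := inv_pos.2 hl
  have hl1 : (2 * d - 1 : ℝ)⁻¹ ≤ 1 / 3 := by
    rw [one_div]
    exact inv_anti₀ (by norm_num) (by linarith)
  have hmul : (2 * d - 1 : ℝ)⁻¹ * (2 * d - 1) = 1 := inv_mul_cancel₀ hl.ne'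
  have hpos (i : Fin d) (x : ℝ) (hx : x ∈ I01) :
      0 < derivWithin (powerBranch d ε i) I01 x := by
    rw [derivWithin_powerBranch hε i hx]
    have := Real.rpow_nonneg hx.1 ε
    split_ifs <;> positivity
  have hlt (i : Fin d) (x : ℝ) (hx : x ∈ I01) :
      derivWithin (powerBranch d ε i) I01 x < 1 := by
    rw [derivWithin_powerBranch hε i hx]
    have h0 := Real.rpow_nonneg hx.1 ε
    have h1 := Real.rpow_le_one hx.1 hx.2 hε.le
    split_ifs
    · have : (1 + (1 + ε) * x ^ ε) / 2 ≤ 3 / 2 := by nlinarith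
      nlinarith
    · linarith
  have hmono (i : Fin d) : MonotoneOn (powerBranch d ε i) I01 := by
    intro x hx y hy hxy
    have := Real.rpow_le_rpow hx.1 hxy (by linarith : 0 ≤ 1 + ε)
    unfold powerBranch
    gcongr
    split_ifs <;> linarith
  refine ⟨fun i x hx => ⟨?_, ?_⟩, fun i => ?_, fun i => ?_, hpos, hlt, fun i j hij => ?_,
    fun i hi => ?_, fun i hi => ?_⟩
  · refine le_trans ?_ (hmono i (by simp) hx hx.1)
    rw [powerBranch_zero hε]
    positivity
  · refine (hmono i hx (by simp) hx.2).trans ?_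
    have : ((i : ℕ) : ℝ) + 1 ≤ d := by exact_mod_cast i.isLt
    rw [powerBranch_one, inv_mul_le_one₀ hl]
    linarith
  · unfold powerBranch
    have := Real.contDiff_rpow_const_of_le (p := 1 + ε) (n := 1) (by simp [hε.le])
    refine ContDiff.contDiffOn (contDiff_const.mul (contDiff_const.add ?_))
    split_ifs
    · exact (contDiff_id.add this).div_const 2
    · exact contDiff_id
  · refine ⟨1, one_pos, fun x hx y hy => ?_⟩
    rw [iteratedDerivWithin_one, derivWithin_powerBranch hε i hx, derivWithin_powerBranch hε i hy,
      ← mul_sub, abs_mul, abs_of_pos hl0]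
    have h := abs_rpow_sub_rpow_le hε.le hε1 hx.1 hy.1
    have h0 : 0 ≤ |x - y| ^ ε := by positivity
    split_ifs
    · rw [show (1 + (1 + ε) * x ^ ε) / 2 - (1 + (1 + ε) * y ^ ε) / 2
        = (1 + ε) / 2 * (x ^ ε - y ^ ε) by ring, abs_mul, abs_of_pos (by positivity)]
      gcongr
      · linarith
      calc _ ≤ 1 * |x ^ ε - y ^ ε| := by gcongr; linarith
        _ ≤ _ := by linarith
    · simpa using h0
  · rw [powerBranch_one, powerBranch_zero hε]
    have : ((i : ℕ) : ℝ) + 1 ≤ (j : ℕ) := by exact_mod_cast hij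
    gcongr
    linarith
  · simp [powerBranch_zero hε, hi]
  · rw [powerBranch_one, hi, Nat.cast_sub (by omega), inv_mul_eq_one₀ hl.ne']
    push_cast
    ring

theorem wordMap_replicate_powerBranch (ε : ℝ) (i : Fin d) (hi : (i : ℕ) = 0) (hd : 2 ≤ d)
    (n : ℕ) (x : ℝ) :
    wordMap (powerBranch d ε) (List.replicate n i) x = (2 * d - 1 : ℝ)⁻¹ ^ n * x := by
  induction n generalizing x with
  | zero => simp [wordMap]
  | succ n ih =>
    simp only [List.replicate_succ, wordMap, ih]
    have : ¬ (0 + 1 = d) := by omega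
    simp only [powerBranch, hi, this, if_false]
    push_cast
    ring

/-- The sequence all of whose entries are `a`, except for the `n`-th one, which is `b`. -/
def spikeSeq (a b : Fin d) (n k : ℕ) : Fin d := if k = n then b else a

theorem dword_spikeSeq (a b : Fin d) (n k : ℕ) :
    dword (spikeSeq a b n) (n + (1 + k)) =
      List.replicate n a ++ b :: List.replicate k a := by
  rw [dword_add, dword_add, ← dword_const, ← dword_const]
  congr 1
  · simp [dword, spikeSeq, Fin.is_lt, ne_of_lt]
  · simp [dword, spikeSeq]

theorem scalingFunction_powerBranch_const {ε : ℝ} {S : (ℕ → Fin d) → Fin (2*d-1) → ℝ}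
    (hS : HasScalingFunction (powerBranch d ε) S) (hd : 2 ≤ d) :
    S (fun _ => ⟨0, by omega⟩) ⟨0, by omega⟩ = (2 * d - 1 : ℝ)⁻¹ := by
  have hd' : (2:ℝ) ≤ d := by exact_mod_cast hd
  have hl0 : (0:ℝ) < (2 * d - 1 : ℝ)⁻¹ := inv_pos.2 (by linarith)
  refine tendsto_nhds_unique (tendsto_pi_nhds.1 (hS _) _) (tendsto_const_nhds.congr fun n => ?_)
  have hpos : 0 < d := by omega
  rw [dword_const]
  simp only [scalingData, hpos, dif_pos]
  rw [wordLen, wordLen, ← List.replicate_succ]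
  simp only [wordMap_replicate_powerBranch ε ⟨0, hpos⟩ rfl hd, mul_one, mul_zero, sub_zero]
  rw [pow_succ, mul_div_cancel_left₀ _ (pow_ne_zero n hl0.ne')]

theorem scalingFunction_powerBranch_spikeSeq {ε : ℝ} (hε : 0 < ε)
    {S : (ℕ → Fin d) → Fin (2*d-1) → ℝ}
    (hS : HasScalingFunction (powerBranch d ε) S) (hd : 2 ≤ d) (n : ℕ) :
    S (spikeSeq ⟨0, by omega⟩ ⟨d - 1, by omega⟩ n) ⟨0, by omega⟩ =
      (2 * d - 1 : ℝ)⁻¹ * (1 + ((2 * d - 1 : ℝ)⁻¹ ^ ε) ^ (n + 1)) /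
        (1 + ((2 * d - 1 : ℝ)⁻¹ ^ ε) ^ n) := by
  have hd' : (2:ℝ) ≤ d := by exact_mod_cast hd
  have hl0 : (0:ℝ) < (2 * d - 1 : ℝ)⁻¹ := inv_pos.2 (by linarith)
  refine tendsto_nhds_unique ((tendsto_pi_nhds.1 (hS _) _).comp (tendsto_add_atTop_nat (n + 1)))
    (tendsto_const_nhds.congr fun k => ?_)
  have hpos : 0 < d := by omega
  have hlast : d - 1 + 1 = d := by omega
  have hpow (n : ℕ) : ((2 * d - 1 : ℝ)⁻¹ ^ n) ^ (1 + ε)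
      = (2 * d - 1 : ℝ)⁻¹ ^ n * ((2 * d - 1 : ℝ)⁻¹ ^ ε) ^ n := by
    rw [Real.rpow_add (by positivity), Real.rpow_one, ← Real.rpow_natCast,
      ← Real.rpow_natCast (_ ^ ε), ← Real.rpow_mul hl0.le, ← Real.rpow_mul hl0.le, mul_comm ε]
  have ht : 0 < (2 * d - 1 : ℝ)⁻¹ ^ ε := by positivity
  rw [Function.comp_apply, show k + (n + 1) = n + (1 + k) by ring, dword_spikeSeq]
  simp only [scalingData, hpos, dif_pos]
  rw [wordLen, wordLen, ← List.cons_append, ← List.replicate_succ]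
  simp only [wordMap_append, wordMap, wordMap_replicate_powerBranch ε ⟨0, hpos⟩ rfl hd, mul_one,
    mul_zero, powerBranch_zero hε]
  simp only [powerBranch, hlast, if_true, hpow]
  set l := (2 * d - 1 : ℝ)⁻¹
  set t := l ^ ε
  have e (c x : ℝ) (y : ℝ) : l ^ k * (l * (c + (x + x * y) / 2)) - l ^ k * (l * c)
      = l ^ k * l * x / 2 * (1 + y) := by ring
  rw [e, e, pow_succ l n]
  field_simp

end PowerExample

/-- A positive sequence whose consecutive ratios tend to a number less than `t` becomes arbitrarily
small compared with `t ^ n`. -/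
theorem tendsto_div_pow_zero_of_tendsto_ratio {y : ℕ → ℝ} {l t : ℝ} (ht : 0 < t) (hlt : l < t)
    (hy : ∀ n, 0 < y n) (h : Tendsto (fun n => y (n + 1) / y n) atTop (nhds l)) :
    Tendsto (fun n => y n / t ^ n) atTop (nhds 0) := by
  refine (summable_of_ratio_test_tendsto_lt_one ((div_lt_one ht).2 hlt)
    (Eventually.of_forall fun n => (div_pos (hy n) (pow_pos ht n)).ne')
    ((h.div_const t).congr fun n => ?_)).tendsto_atTop_zero
  have h0 := hy n
  have h1 := hy (n + 1)
  rw [Real.norm_of_nonneg (by positivity), Real.norm_of_nonneg (by positivity), pow_succ]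
  field_simp

/-- Example 1: for all `0 < ε₁ < ε₂ ≤ 1` there is a scaling function realized
by some `C^{1+ε₁}` Cantor system but by no `C^{1+ε₂}` Cantor system. -/
theorem stmt17 (d : ℕ) (hd : 2 ≤ d) (ε₁ ε₂ : ℝ) (h1 : 0 < ε₁) (h12 : ε₁ < ε₂) (h2 : ε₂ ≤ 1) :
    ∃ S : (ℕ → Fin d) → Fin (2*d-1) → ℝ,
      (∃ g : Fin d → ℝ → ℝ, IsCantorSystem 1 ε₁ g ∧ HasScalingFunction g S) ∧
      ¬ (∃ g : Fin d → ℝ → ℝ, IsCantorSystem 1 ε₂ g ∧ HasScalingFunction g S) := by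
  have hε₁ : ε₁ ≤ 1 := h12.le.trans h2
  have hd' : (2:ℝ) ≤ d := by exact_mod_cast hd
  have hg := isCantorSystem_powerBranch hd h1 hε₁
  obtain ⟨S, hS⟩ := hg.exists_hasScalingFunction h1
  refine ⟨S, ⟨_, hg, hS⟩, ?_⟩
  rintro ⟨h, hh, hSh⟩
  obtain ⟨C, hC, hbound⟩ := hh.exists_scalingFunction_sub_le (h1.trans h12) hSh
  have hconst := scalingFunction_powerBranch_const hS hd
  have hspike := scalingFunction_powerBranch_spikeSeq h1 hS hd
  set l := (2 * d - 1 : ℝ)⁻¹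
  have hl0 : 0 < l := inv_pos.2 (by linarith)
  have hl1 : l < 1 := inv_lt_one_of_one_lt₀ (by linarith)
  set t := l ^ ε₁
  have ht0 : 0 < t := by positivity
  have ht1 : t < 1 := Real.rpow_lt_one hl0.le hl1 h1
  set a : Fin d := ⟨0, by omega⟩
  set x : ℕ → ℝ := fun n => wordLen h (List.replicate n a)
  have hx (n : ℕ) : 0 < x n := hh.wordLen_pos _
  have hratio : Tendsto (fun n => x (n + 1) / x n) atTop (nhds l) := by
    have := tendsto_pi_nhds.1 (hSh fun _ => a) ⟨0, by omega⟩
    rw [hconst] at this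
    refine this.congr fun n => ?_
    have hpos : 0 < d := by omega
    rw [dword_const]
    simp only [scalingData, hpos, dif_pos]
    rfl
  have hlim : Tendsto (fun n => x n ^ ε₂ / t ^ n) atTop (nhds 0) := by
    refine tendsto_div_pow_zero_of_tendsto_ratio ht0
      (Real.rpow_lt_rpow_of_exponent_gt hl0 hl1 h12) (fun n => Real.rpow_pos_of_pos (hx n) _)
      ((hratio.rpow_const (Or.inl hl0.ne')).congr fun n => ?_)
    rw [Real.div_rpow (hx _).le (hx _).le]
  have hlower (n : ℕ) : l * (1 - t) / (2 * C) ≤ x n ^ ε₂ / t ^ n := by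
    have hb := hbound (fun _ => a) (spikeSeq a ⟨d - 1, by omega⟩ n) n ⟨0, by omega⟩
      (by simp [dword, spikeSeq, Fin.is_lt, ne_of_lt])
    rw [hconst, hspike, dword_const] at hb
    have htn := pow_pos ht0 n
    have htn1 : t ^ n ≤ 1 := pow_le_one₀ ht0.le ht1.le
    have h1t := sub_pos.2 ht1
    have e : l - l * (1 + t ^ (n + 1)) / (1 + t ^ n) = l * (1 - t) * t ^ n / (1 + t ^ n) := by
      field_simp
      ring
    have hge : l * (1 - t) * t ^ n / 2 ≤ C * x n ^ ε₂ := by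
      refine le_trans ?_ ((le_abs_self _).trans hb)
      rw [e]
      gcongr
      linarith
    rw [div_le_div_iff₀ (by positivity) htn]
    linarith
  have := ge_of_tendsto' hlim hlower
  have : 0 < l * (1 - t) / (2 * C) := div_pos (mul_pos hl0 (sub_pos.2 ht1)) (by positivity)
  linarith
end
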